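/- arXiv:2505.09004 — 3 statements merged into one kernel-verified Lean document; each statement's English description precedes it below -/
import Mathlib

section
/- Let p, p_N ∈ (0,1), σ > 0, and define θ^σ : ℝ → ℝ by θ^σ(x) = log(p/(1−p)) + log( (p_N + (1−p_N) e^{(2x−1)/(2σ²)}) / ((1−p_N) + p_N e^{(2x−1)/(2σ²)}) ). Then for Z ~ N(0,1), E[Z θ^σ(σZ)] = E[Z θ^σ(1 + σZ)]. -/
open MeasureTheory ProbabilityTheory

/-- The channel log-likelihood-ratio term of the binary symmetric channel is odd in its argument. -/
lemma log_bsc_ratio_neg {q : ℝ} (hq : q ∈ Set.Ioo (0 : ℝ) 1) (u : ℝ) :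
    Real.log ((q + (1 - q) * Real.exp (-u)) / ((1 - q) + q * Real.exp (-u)))
      = -Real.log ((q + (1 - q) * Real.exp u) / ((1 - q) + q * Real.exp u)) := by
  have h₀ : 0 < q := hq.1
  have h₁ : 0 < 1 - q := sub_pos.2 hq.2
  have hu : 0 < Real.exp u := Real.exp_pos u
  rw [← Real.log_inv, Real.exp_neg, inv_div]
  congr 1
  have hnum : q + (1 - q) * (Real.exp u)⁻¹ = ((1 - q) + q * Real.exp u) * (Real.exp u)⁻¹ := by
    field_simp
    ring
  have hden : (1 - q) + q * (Real.exp u)⁻¹ = (q + (1 - q) * Real.exp u) * (Real.exp u)⁻¹ := by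
    field_simp
    ring
  rw [hnum, hden, mul_div_mul_right _ _ (inv_ne_zero hu.ne')]

/-- Subtracting a centred integrable function does not change the Bochner integral, whether or not
the minuend is integrable. -/
lemma integral_sub_of_integral_eq_zero {α : Type*} [MeasurableSpace α] {μ : Measure α}
    {f g : α → ℝ} (hg : Integrable g μ) (hg₀ : ∫ x, g x ∂μ = 0) :
    ∫ x, (f x - g x) ∂μ = ∫ x, f x ∂μ := by
  by_cases hf : Integrable f μ
  · rw [integral_sub hf hg, hg₀, sub_zero]
  · have hfg : ¬ Integrable (fun x => f x - g x) μ := fun h =>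
      hf ((h.add hg).congr (Filter.Eventually.of_forall fun x => by simp))
    rw [integral_undef hf, integral_undef hfg]

/-- If `θ (1 - x) + θ x` is constant, then `θ (σ Z)` and `θ (1 + σ Z)` have the same correlation
with a standard Gaussian `Z`. -/
lemma integral_mul_gaussianReal_eq_of_reflection {θ : ℝ → ℝ} {c : ℝ}
    (h : ∀ x, θ (1 - x) = c - θ x) (σ : ℝ) :
    ∫ z, z * θ (σ * z) ∂(gaussianReal 0 1) = ∫ z, z * θ (1 + σ * z) ∂(gaussianReal 0 1) := by
  have hneg : (gaussianReal 0 1).map (fun z : ℝ => -z) = gaussianReal 0 1 := by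
    rw [gaussianReal_map_neg, neg_zero]
  have hint : Integrable (fun z : ℝ => z * c) (gaussianReal 0 1) :=
    ((memLp_id_gaussianReal 1).integrable (by simp)).mul_const c
  have hzero : ∫ z, z * c ∂(gaussianReal 0 1) = 0 := by
    rw [integral_mul_const, integral_id_gaussianReal, zero_mul]
  calc ∫ z, z * θ (σ * z) ∂(gaussianReal 0 1)
      = ∫ z, (z * θ (σ * z) - z * c) ∂(gaussianReal 0 1) :=
        (integral_sub_of_integral_eq_zero hint hzero).symm
    _ = ∫ z, -z * θ (1 + σ * -z) ∂(gaussianReal 0 1) := by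
        refine integral_congr_ae (Filter.Eventually.of_forall fun z => ?_)
        have hz : θ (1 + σ * -z) = c - θ (σ * z) := by
          rw [← h, mul_neg, ← sub_eq_add_neg]
        simp only [hz]
        ring
    _ = ∫ z, z * θ (1 + σ * z) ∂((gaussianReal 0 1).map fun z : ℝ => -z) :=
        ((MeasurableEquiv.neg ℝ).measurableEmbedding.integral_map
          (fun z => z * θ (1 + σ * z))).symm
    _ = ∫ z, z * θ (1 + σ * z) ∂(gaussianReal 0 1) := by rw [hneg]

/-- Symmetry identity for the BSC log posterior-odds: for `Z ~ N(0,1)`,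
`E[Z θ^σ(σZ)] = E[Z θ^σ(1 + σZ)]`. -/
theorem bsc_symmetry_identity
    (p pN : ℝ) (hp : p ∈ Set.Ioo (0 : ℝ) 1) (hpN : pN ∈ Set.Ioo (0 : ℝ) 1)
    (σ : ℝ) (hσ : 0 < σ)
    (θ : ℝ → ℝ)
    (hθ : θ = fun x => Real.log (p / (1 - p))
      + Real.log ((pN + (1 - pN) * Real.exp ((2 * x - 1) / (2 * σ ^ 2)))
          / ((1 - pN) + pN * Real.exp ((2 * x - 1) / (2 * σ ^ 2))))) :
    ∫ z, z * θ (σ * z) ∂(gaussianReal 0 1)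
      = ∫ z, z * θ (1 + σ * z) ∂(gaussianReal 0 1) := by
  refine integral_mul_gaussianReal_eq_of_reflection (c := 2 * Real.log (p / (1 - p)))
    (fun x => ?_) σ
  have hx : (2 * (1 - x) - 1) / (2 * σ ^ 2) = -((2 * x - 1) / (2 * σ ^ 2)) := by ring
  simp only [hθ, hx, log_bsc_ratio_neg hpN]
  ring
end

section
/- Let S ~ Bernoulli(p) with p ∈ (0,1) and p̄ := 1 − p, suppose the conditional distribution of X given S = s is N(μ_s, Σ_s) for s ∈ {0,1} with μ_s ∈ ℝ^d and Σ_s positive definite, let σ > 0, and let X^σ := X + σZ with Z ~ N(0, I_d) independent of (X, S). Set Σ̃_s := Σ_s + σ²I, μ_d := μ_1 − μ_0, A := (1/2)(Σ̃_0⁻¹ − Σ̃_1⁻¹), b := Σ̃_1⁻¹μ_1 − Σ̃_0⁻¹μ_0, c := (1/2)μ_0ᵀΣ̃_0⁻¹μ_0 − (1/2)μ_1ᵀΣ̃_1⁻¹μ_1 + (1/2)log(det Σ̃_0/det Σ̃_1) + log(p/p̄). For s ∈ {0,1}, let λ_1^{(s)}, …, λ_d^{(s)} be the eigenvalues of Σ̃_s^{1/2}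 A Σ̃_s^{1/2}, let Q_s be an orthogonal matrix with Q_sᵀ Σ̃_s^{1/2} A Σ̃_s^{1/2} Q_s = diag(λ_1^{(s)}, …, λ_d^{(s)}), and set u^{(s)} := Q_sᵀ Σ̃_s^{1/2}(b + 2Aμ_s), M_s := ∑_{j=1}^d λ_j^{(s)} + bᵀμ_s + μ_sᵀAμ_s + c, and V_s := ∑_{j=1}^d (2(λ_j^{(s)})² + (u_j^{(s)})²). Define VAR₁ := pV_1 + p̄V_0 + p p̄ (M_1 − M_0)², COV := 2p μ_1ᵀAΣ_1 + 2p̄ μ_0ᵀAΣ_0 + 2σ²(pμ_1 + p̄μ_0)ᵀA + p p̄ [tr(A(Σ_1 − Σ_0)) + μ_1ᵀAμ_1 − μ_0ᵀAμ_0] μ_dᵀ + bᵀ[pΣ_1 + p̄Σ_0 + σ²I + p p̄ μ_d μ_dᵀ], and VAR₂ := pΣ_1 + p̄Σ_0 + p p̄ μ_d μ_dᵀ + σ²I. Then the approximation error ε_A := inf over functions of the form x ↦ s(aᵀx + β) (a ∈ ℝ^d, β ∈ ℝ, s the sigmoid) of E[(η^σ(X^σ) − h(X^σ))²] satisfies ε_A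 ≤ (1/4)(VAR₁ − COV · VAR₂⁻¹ · COVᵀ). -/
open MeasureTheory ProbabilityTheory Matrix

/-- The `N(m, C)` Lebesgue density on `ℝ^d`. -/
noncomputable def gaussDensity {d : ℕ} (m : Fin d → ℝ) (C : Matrix (Fin d) (Fin d) ℝ)
    (x : Fin d → ℝ) : ℝ :=
  (Real.sqrt ((2 * Real.pi) ^ d * C.det))⁻¹ *
    Real.exp (-(1 / 2) * ((x - m) ⬝ᵥ (C⁻¹ *ᵥ (x - m))))

lemma integral_pow_gaussianReal_zero_one :
    (∫ x, x ^ 2 ∂gaussianReal 0 1 = 1) ∧ (∫ x, x ^ 3 ∂gaussianReal 0 1 = 0) ∧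
      ∫ x, x ^ 4 ∂gaussianReal 0 1 = 3 := by
  have hmgf : mgf (fun x ↦ x) (gaussianReal 0 1) = fun t ↦ Real.exp (t ^ 2 / 2) := by
    simp [mgf_fun_id_gaussianReal]
  have key (P P' : ℝ → ℝ) (h : ∀ t, HasDerivAt P (P' t) t) :
      deriv (fun t ↦ P t * Real.exp (t ^ 2 / 2)) =
        fun t ↦ (P' t + t * P t) * Real.exp (t ^ 2 / 2) := by
    ext t
    have h2 : HasDerivAt (fun t : ℝ ↦ t ^ 2 / 2) t t := by
      simpa using (hasDerivAt_pow 2 t).div_const 2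
    exact ((h t).mul h2.exp).deriv.trans (by ring)
  have d1 : deriv (fun t : ℝ ↦ Real.exp (t ^ 2 / 2)) = fun t ↦ t * Real.exp (t ^ 2 / 2) := by
    simpa using key (fun _ ↦ 1) (fun _ ↦ 0) fun t ↦ hasDerivAt_const t 1
  have d2 := key (fun t ↦ t) (fun _ ↦ 1) fun t ↦ hasDerivAt_id t
  have d3 := key (fun t ↦ 1 + t * t) (fun t ↦ 2 * t) fun t ↦ by
    convert! ((hasDerivAt_id t).mul (hasDerivAt_id t)).const_add 1 using 1
    simp; ring
  have d4 := key (fun t ↦ 2 * t + t * (1 + t * t)) (fun t ↦ 3 + 3 * t ^ 2) fun t ↦ by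
    convert! ((hasDerivAt_id t).const_mul 2).add
      ((hasDerivAt_id t).mul (((hasDerivAt_id t).mul (hasDerivAt_id t)).const_add 1)) using 1
    simp; ring
  have hm (n : ℕ) : ∫ x, x ^ n ∂gaussianReal 0 1 =
      iteratedDeriv n (mgf (fun x ↦ x) (gaussianReal 0 1)) 0 := by
    rw [iteratedDeriv_mgf_zero] <;> simp
  simp only [hm, hmgf, iteratedDeriv_succ, iteratedDeriv_zero, d1, d2, d3, d4]
  norm_num

lemma memLp_quadratic_gaussianReal (l w : ℝ) :
    MemLp (fun x ↦ l * (x ^ 2 - 1) + w * x) 2 (gaussianReal 0 1) := by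
  have h1 : MemLp (fun x : ℝ ↦ x) 2 (gaussianReal 0 1) := memLp_id_gaussianReal 2
  have h2 : MemLp (fun x : ℝ ↦ x ^ 2) 2 (gaussianReal 0 1) := by
    rw [memLp_two_iff_integrable_sq (by fun_prop)]
    have := (memLp_id_gaussianReal (μ := 0) (v := 1) 4).integrable_norm_pow (p := 4) (by norm_num)
    refine this.congr (ae_of_all _ fun x ↦ ?_)
    simp [← pow_mul, (show Even 4 by decide).pow_abs]
  exact ((h2.sub (memLp_const 1)).const_mul l).add (h1.const_mul w)

lemma integral_quadratic_gaussianReal (l w : ℝ) :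
    ∫ x, (l * (x ^ 2 - 1) + w * x) ∂gaussianReal 0 1 = 0 := by
  have h1 : Integrable (fun x : ℝ ↦ x) (gaussianReal 0 1) :=
    (memLp_id_gaussianReal 1).integrable (by simp)
  have h2 : Integrable (fun x : ℝ ↦ x ^ 2) (gaussianReal 0 1) :=
    (memLp_id_gaussianReal 2).integrable_sq
  have h3 : Integrable (fun x : ℝ ↦ x ^ 2 - 1) (gaussianReal 0 1) := h2.sub (integrable_const 1)
  rw [integral_add (h3.const_mul l) (h1.const_mul w),
    integral_const_mul, integral_const_mul, integral_sub h2 (integrable_const 1),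
    integral_pow_gaussianReal_zero_one.1]
  simp

lemma variance_quadratic_gaussianReal (l w : ℝ) :
    Var[fun x ↦ l * (x ^ 2 - 1) + w * x; gaussianReal 0 1] = 2 * l ^ 2 + w ^ 2 := by
  obtain ⟨m2, m3, m4⟩ := integral_pow_gaussianReal_zero_one
  have hi (n : ℕ) : Integrable (fun x : ℝ ↦ x ^ n) (gaussianReal 0 1) := by
    have h := (memLp_id_gaussianReal (μ := 0) (v := 1) n).integrable_norm_pow'
    exact (integrable_norm_iff (by fun_prop)).1 (by simpa using h)
  rw [variance_of_integral_eq_zero (by fun_prop) (integral_quadratic_gaussianReal l w)]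
  calc ∫ x, (l * (x ^ 2 - 1) + w * x) ^ 2 ∂gaussianReal 0 1
      = ∫ x, (l ^ 2 * x ^ 4 + 2 * l * w * x ^ 3 + (w ^ 2 - 2 * l ^ 2) * x ^ 2
          + (-(2 * l * w)) * x ^ 1 + l ^ 2) ∂gaussianReal 0 1 := by
        congr with x; ring
    _ = 2 * l ^ 2 + w ^ 2 := by
        have m1 : ∫ x, x ^ 1 ∂gaussianReal 0 1 = 0 := by simp
        rw [integral_add (by fun_prop) (by fun_prop), integral_add (by fun_prop) (by fun_prop),
          integral_add (by fun_prop) (by fun_prop), integral_add (by fun_prop) (by fun_prop)]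
        simp only [integral_const_mul, m1, m2, m3, m4]
        simp; ring

/-- The standard Gaussian measure on `Fin d → ℝ`. -/
noncomputable abbrev stdGaussianPi (d : ℕ) : Measure (Fin d → ℝ) :=
  Measure.pi fun _ ↦ gaussianReal 0 1

lemma memLp_sum_quadratic_pi {d : ℕ} (m : ℝ) (l w : Fin d → ℝ) :
    MemLp (fun y : Fin d → ℝ ↦ m + ∑ j, (l j * (y j ^ 2 - 1) + w j * y j)) 2 (stdGaussianPi d) :=
  (memLp_const m).add <| memLp_finsetSum _ fun j _ ↦
    (memLp_quadratic_gaussianReal (l j) (w j)).comp_measurePreserving (measurePreserving_eval _ j)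

lemma integral_sq_sum_quadratic_pi {d : ℕ} (m : ℝ) (l w : Fin d → ℝ) :
    ∫ y : Fin d → ℝ, (m + ∑ j, (l j * (y j ^ 2 - 1) + w j * y j)) ^ 2 ∂(stdGaussianPi d) =
      m ^ 2 + ∑ j, (2 * l j ^ 2 + w j ^ 2) := by
  have hmem := memLp_sum_quadratic_pi 0 l w
  simp only [zero_add] at hmem
  have h0 : ∫ y : Fin d → ℝ, (∑ j, (l j * (y j ^ 2 - 1) + w j * y j)) ∂(stdGaussianPi d) = 0 := by
    rw [integral_finsetSum]
    · refine Finset.sum_eq_zero fun j _ ↦ ?_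
      rw [integral_comp_eval (μ := fun _ : Fin d ↦ gaussianReal 0 1)
        (f := fun x ↦ l j * (x ^ 2 - 1) + w j * x) (by fun_prop)]
      exact integral_quadratic_gaussianReal _ _
    · intro j _
      exact integrable_comp_eval (μ := fun _ : Fin d ↦ gaussianReal 0 1)
        ((memLp_quadratic_gaussianReal (l j) (w j)).integrable one_le_two)
  have hv := variance_sum_pi (μ := fun _ : Fin d ↦ gaussianReal 0 1)
    fun j ↦ memLp_quadratic_gaussianReal (l j) (w j)
  simp only [variance_quadratic_gaussianReal] at hv
  have hfun : (∑ j, fun y : Fin d → ℝ ↦ l j * (y j ^ 2 - 1) + w j * y j) =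
      fun y ↦ ∑ j, (l j * (y j ^ 2 - 1) + w j * y j) := by ext; simp
  rw [hfun, variance_of_integral_eq_zero (by fun_prop) h0] at hv
  rw [← hv]
  have hi := hmem.integrable one_le_two
  calc _ = ∫ y : Fin d → ℝ, (m ^ 2 + 2 * m * (∑ j, (l j * (y j ^ 2 - 1) + w j * y j))
        + (∑ j, (l j * (y j ^ 2 - 1) + w j * y j)) ^ 2) ∂(stdGaussianPi d) := by congr with y; ring
    _ = _ := by
      rw [integral_add (by fun_prop) hmem.integrable_sq, integral_add (by fun_prop) (by fun_prop),
        integral_const_mul, h0]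
      simp

lemma stdGaussianPi_eq_withDensity (d : ℕ) :
    stdGaussianPi d = volume.withDensity
      fun y ↦ ENNReal.ofReal (∏ j, gaussianPDFReal 0 1 (y j)) := by
  refine (Measure.pi_eq fun s hs ↦ ?_)
  have h_int : Integrable (fun y : Fin d → ℝ ↦ ∏ j, gaussianPDFReal 0 1 (y j)) :=
    Integrable.fintype_prod fun _ ↦ integrable_gaussianPDFReal 0 1
  rw [withDensity_apply _ (MeasurableSet.univ_pi hs),
    ← ofReal_integral_eq_lintegral_ofReal h_int.integrableOn
      (ae_of_all _ fun y ↦ Finset.prod_nonneg fun j _ ↦ gaussianPDFReal_nonneg _ _ _),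
    volume_pi, Measure.restrict_pi_pi,
    integral_fintype_prod_eq_prod (fun _ ↦ gaussianPDFReal 0 1),
    ENNReal.ofReal_prod_of_nonneg
      fun j _ ↦ integral_nonneg fun y ↦ gaussianPDFReal_nonneg _ _ _]
  exact Finset.prod_congr rfl fun j _ ↦ (gaussianReal_apply_eq_integral 0 one_ne_zero _).symm

lemma measurable_gaussDensity {d : ℕ} (m : Fin d → ℝ) (C : Matrix (Fin d) (Fin d) ℝ) :
    Measurable (gaussDensity m C) := by
  refine Continuous.measurable ?_
  unfold gaussDensity
  fun_prop

lemma gaussDensity_affine {d : ℕ} (m : Fin d → ℝ) {B : Matrix (Fin d) (Fin d) ℝ}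
    (hB : B.det ≠ 0) (y : Fin d → ℝ) :
    |B.det| * gaussDensity m (B * Bᵀ) (m + B *ᵥ y) = ∏ j, gaussianPDFReal 0 1 (y j) := by
  have hq : (B *ᵥ y) ⬝ᵥ ((B * Bᵀ)⁻¹ *ᵥ (B *ᵥ y)) = ∑ j, y j ^ 2 := by
    have hBt : Bᵀ.det ≠ 0 := by rwa [det_transpose]
    rw [Matrix.mul_inv_rev, mulVec_mulVec, Matrix.mul_assoc, nonsing_inv_mul _ hB.isUnit, Matrix.mul_one,
      dotProduct_mulVec, ← vecMul_transpose, vecMul_vecMul, mul_nonsing_inv _ hBt.isUnit,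
      vecMul_one]
    simp [dotProduct, sq]
  have hs : √((2 * Real.pi) ^ d * (B * Bᵀ).det) = √(2 * Real.pi) ^ d * |B.det| := by
    rw [det_mul, det_transpose, ← sq, Real.sqrt_mul (by positivity), Real.sqrt_sq_eq_abs,
      Real.sqrt_eq_rpow, Real.sqrt_eq_rpow, ← Real.rpow_natCast, ← Real.rpow_natCast,
      ← Real.rpow_mul (by positivity), ← Real.rpow_mul (by positivity), mul_comm (d : ℝ)]
  have hB' : |B.det| ≠ 0 := abs_ne_zero.2 hB
  simp only [gaussDensity, add_sub_cancel_left, hq, hs, gaussianPDFReal, Finset.prod_mul_distrib,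
    ← Real.exp_sum, Finset.prod_const, Finset.card_univ, Fintype.card_fin, NNReal.coe_one, mul_one,
    sub_zero, Finset.mul_sum]
  rw [inv_pow, mul_inv]
  field_simp

/-- An invertible affine image of the standard Gaussian has Gaussian density. -/
lemma map_affine_stdGaussianPi {d : ℕ} (m : Fin d → ℝ) {B : Matrix (Fin d) (Fin d) ℝ}
    (hB : B.det ≠ 0) :
    (stdGaussianPi d).map (fun y ↦ m + B *ᵥ y) =
      volume.withDensity fun x ↦ ENNReal.ofReal (gaussDensity m (B * Bᵀ) x) := by
  have hT : Measurable fun y : Fin d → ℝ ↦ m + B *ᵥ y := by fun_prop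
  have hvol : (volume : Measure (Fin d → ℝ)) =
      ENNReal.ofReal |B.det| • volume.map (fun y : Fin d → ℝ ↦ m + B *ᵥ y) := by
    have h1 := Real.map_matrix_volume_pi_eq_smul_volume_pi hB
    have h2 : (volume : Measure (Fin d → ℝ)).map (fun y : Fin d → ℝ ↦ m + B *ᵥ y) =
        (volume.map (toLin' B)).map (fun x ↦ m + x) := by
      rw [Measure.map_map (by fun_prop) (by fun_prop)]
      rfl
    rw [h2, h1, Measure.map_smul, map_add_left_eq_self, smul_smul,
      ← ENNReal.ofReal_mul (abs_nonneg _), ← abs_mul, mul_inv_cancel₀ hB]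
    simp
  ext s hs
  have hf : Measurable fun x ↦ ENNReal.ofReal (gaussDensity m (B * Bᵀ) x) :=
    (measurable_gaussDensity m _).ennreal_ofReal
  rw [Measure.map_apply hT hs, stdGaussianPi_eq_withDensity, withDensity_apply _ (hT hs),
    withDensity_apply _ hs]
  conv_rhs => rw [hvol]
  rw [Measure.restrict_smul, lintegral_smul_measure, setLIntegral_map hs hf hT, smul_eq_mul,
    ← lintegral_const_mul' _ _ ENNReal.ofReal_ne_top]
  refine lintegral_congr fun y ↦ ?_
  rw [← gaussDensity_affine m hB, ENNReal.ofReal_mul (abs_nonneg _)]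

lemma charFunDual_map_affine_stdGaussianPi {d : ℕ} (m : Fin d → ℝ)
    (B : Matrix (Fin d) (Fin d) ℝ) (L : StrongDual ℝ (Fin d → ℝ)) (t : Fin d → ℝ)
    (hL : ∀ x, L x = t ⬝ᵥ x) :
    charFunDual ((stdGaussianPi d).map (fun y ↦ m + B *ᵥ y)) L =
      Complex.exp ((t ⬝ᵥ m : ℝ) * Complex.I - (t ⬝ᵥ ((B * Bᵀ) *ᵥ t) : ℝ) / 2) := by
  have hmap : (stdGaussianPi d).map (fun y ↦ m + B *ᵥ y) =
      ((stdGaussianPi d).map (Matrix.toLin' B).toContinuousLinearMap).map (fun x ↦ m + x) := by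
    rw [Measure.map_map (by fun_prop) (by fun_prop)]
    rfl
  have hsum : t ⬝ᵥ ((B * Bᵀ) *ᵥ t) = ∑ j, (t ᵥ* B) j ^ 2 := by
    rw [← mulVec_mulVec, dotProduct_mulVec, mulVec_transpose]
    simp [dotProduct, sq]
  rw [hmap, charFunDual_map_const_add, charFunDual_map, charFunDual_pi, hsum, sub_eq_add_neg,
    Complex.exp_add, hL, mul_comm]
  congr 1
  have hBj (j : Fin d) : L (B.col j) = (t ᵥ* B) j := by
    rw [hL, ← mulVec_single_one, dotProduct_mulVec, dotProduct_single_one]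
  have hj (K : StrongDual ℝ ℝ) :
      charFunDual (gaussianReal 0 1) K = Complex.exp (-((K 1 ^ 2 : ℝ) / 2)) := by
    rw [IsGaussian.charFunDual_eq, integral_complex_ofReal,
      integral_continuousLinearMap_gaussianReal, variance_continuousLinearMap_gaussianReal]
    simp [Real.coe_toNNReal _ (sq_nonneg _)]
  simp only [hj, ← Complex.exp_sum]
  congr 1
  simp [hBj, Finset.sum_div]

/-- Adding an independent isotropic Gaussian to a Gaussian vector adds the covariances. -/
lemma map_add_smul_eq_map_affine_stdGaussianPi {Ω : Type*} [MeasurableSpace Ω] {P : Measure Ω}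
    [IsProbabilityMeasure P] {d : ℕ} {X Z : Ω → Fin d → ℝ} (hX : Measurable X) (hZ : Measurable Z)
    (hXZ : IndepFun X Z P) {m : Fin d → ℝ} {B B' : Matrix (Fin d) (Fin d) ℝ} {σ : ℝ}
    (hXlaw : P.map X = (stdGaussianPi d).map fun y ↦ m + B *ᵥ y)
    (hZlaw : P.map Z = stdGaussianPi d)
    (hB : B' * B'ᵀ = B * Bᵀ + σ ^ 2 • (1 : Matrix (Fin d) (Fin d) ℝ)) :
    P.map (fun ω ↦ X ω + σ • Z ω) = (stdGaussianPi d).map fun y ↦ m + B' *ᵥ y := by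
  have hσZ : P.map (fun ω ↦ σ • Z ω) =
      (stdGaussianPi d).map fun y ↦ 0 + (σ • (1 : Matrix (Fin d) (Fin d) ℝ)) *ᵥ y := by
    rw [← hZlaw, Measure.map_map (by fun_prop) hZ]
    congr 1
    ext ω : 1
    simp [smul_mulVec]
  have : IsProbabilityMeasure (P.map fun ω ↦ X ω + σ • Z ω) :=
    Measure.isProbabilityMeasure_map (by fun_prop)
  have : IsProbabilityMeasure ((stdGaussianPi d).map fun y ↦ m + B' *ᵥ y) :=
    Measure.isProbabilityMeasure_map (by fun_prop)
  refine Measure.ext_of_charFunDual <| funext fun L ↦ ?_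
  have hL (x : Fin d → ℝ) : L x = (fun j ↦ L (Pi.single j 1)) ⬝ᵥ x := by
    conv_lhs => rw [pi_eq_sum_univ' x, map_sum]
    exact Finset.sum_congr rfl fun j _ ↦ by
      rw [map_smul, smul_eq_mul, mul_comm]
  have hXσZ : IndepFun X (fun ω ↦ σ • Z ω) P :=
    hXZ.comp measurable_id (measurable_id.const_smul σ)
  rw [hXσZ.charFunDual_map_fun_add_eq_mul hX.aemeasurable (by fun_prop), Pi.mul_apply, hXlaw, hσZ,
    charFunDual_map_affine_stdGaussianPi _ _ L _ hL, charFunDual_map_affine_stdGaussianPi _ _ L _ hL,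
    charFunDual_map_affine_stdGaussianPi _ _ L _ hL, ← Complex.exp_add, hB]
  congr 1
  have hσ : (σ • (1 : Matrix (Fin d) (Fin d) ℝ)) * (σ • (1 : Matrix (Fin d) (Fin d) ℝ))ᵀ =
      σ ^ 2 • 1 := by
    simp [smul_smul, sq]
  simp only [hσ, dotProduct_zero, add_mulVec, dotProduct_add]
  push_cast
  ring

lemma IndepFun.cond_of_prodMk {Ω α β ι : Type*} [MeasurableSpace Ω] [MeasurableSpace α]
    [MeasurableSpace β] [MeasurableSpace ι] {P : Measure Ω} [IsProbabilityMeasure P]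
    {X : Ω → α} {Z : Ω → β} {S : Ω → ι} (hZ : Measurable Z)
    (hS : Measurable S) (h : IndepFun Z (fun ω ↦ (X ω, S ω)) P) {T : Set ι} (hT : MeasurableSet T)
    (hPT : P (S ⁻¹' T) ≠ 0) :
    IndepFun X Z P[|S ⁻¹' T] ∧ P[|S ⁻¹' T].map Z = P.map Z := by
  have hT' : MeasurableSet (S ⁻¹' T) := hS hT
  rw [indepFun_iff_measure_inter_preimage_eq_mul] at h
  have hcond (A : Set α) (B : Set β) (hA : MeasurableSet A) (hB : MeasurableSet B) :
      P[|S ⁻¹' T] (X ⁻¹' A ∩ Z ⁻¹' B) = P[|S ⁻¹' T] (X ⁻¹' A) * P (Z ⁻¹' B) := by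
    have := h B (A ×ˢ T) hB (hA.prod hT)
    have hpre : (fun ω ↦ (X ω, S ω)) ⁻¹' (A ×ˢ T) = S ⁻¹' T ∩ X ⁻¹' A := by
      ext; simp [and_comm]
    rw [hpre] at this
    rw [cond_apply hT', cond_apply hT', ← Set.inter_assoc, Set.inter_comm, this]
    ring
  have hZlaw (B : Set β) (hB : MeasurableSet B) : P[|S ⁻¹' T] (Z ⁻¹' B) = P (Z ⁻¹' B) := by
    have : IsProbabilityMeasure P[|S ⁻¹' T] := cond_isProbabilityMeasure hPT
    simpa using hcond Set.univ B MeasurableSet.univ hB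
  refine ⟨?_, ?_⟩
  · rw [indepFun_iff_measure_inter_preimage_eq_mul]
    intro A B hA hB
    rw [hcond A B hA hB, hZlaw B hB]
  · ext B hB
    rw [Measure.map_apply hZ hB, Measure.map_apply hZ hB, hZlaw B hB]

/-- Bayes' formula for a binary label with class-conditional densities. -/
lemma posterior_ae_eq_condExp {Ω E : Type*} [MeasurableSpace Ω] [MeasurableSpace E]
    {P : Measure Ω} [IsProbabilityMeasure P] {ν : Measure E} {Y : Ω → E} {S : Ω → ℝ}
    (hY : Measurable Y) (hS : Measurable S) (hS01 : ∀ ω, S ω = 0 ∨ S ω = 1)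
    {g0 g1 q : E → ℝ} (hg0 : Measurable g0) (hg1 : Measurable g1) (hq : Measurable q)
    (hg0_nonneg : ∀ x, 0 ≤ g0 x) (hg1_nonneg : ∀ x, 0 ≤ g1 x)
    (hq_nonneg : ∀ x, 0 ≤ q x) (hq_le : ∀ x, q x ≤ 1)
    (h0 : (P.restrict {ω | S ω = 0}).map Y = ν.withDensity fun x ↦ ENNReal.ofReal (g0 x))
    (h1 : (P.restrict {ω | S ω = 1}).map Y = ν.withDensity fun x ↦ ENNReal.ofReal (g1 x))
    (hbayes : ∀ x, q x * (g0 x + g1 x) = g1 x) :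
    (fun ω ↦ q (Y ω)) =ᵐ[P] P[S | MeasurableSpace.comap Y inferInstance] := by
  have hS1 : MeasurableSet {ω | S ω = 1} := hS (measurableSet_singleton 1)
  have hSc : {ω | S ω = 1}ᶜ = {ω | S ω = 0} := by
    ext ω
    rcases hS01 ω with h | h <;> simp [h]
  have hPY : P.map Y = ν.withDensity fun x ↦ ENNReal.ofReal (g0 x + g1 x) := by
    rw [← Measure.restrict_add_restrict_compl (μ := P) hS1, hSc, Measure.map_add _ _ hY, h0, h1,
      add_comm, ← withDensity_add_left (by fun_prop)]
    congr with x
    exact (ENNReal.ofReal_add (hg0_nonneg x) (hg1_nonneg x)).symm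
  have hSi : S = {ω | S ω = 1}.indicator 1 := by
    ext ω
    rcases hS01 ω with h | h <;> simp [h]
  have hSint : Integrable S P := by
    rw [hSi]
    exact (integrable_const (1 : ℝ)).indicator hS1
  have hqint : Integrable (fun ω ↦ q (Y ω)) P := by
    refine Integrable.of_bound (C := 1) (hq.comp hY).aestronglyMeasurable
      (ae_of_all _ fun ω ↦ ?_)
    rw [Real.norm_of_nonneg (hq_nonneg _)]
    exact hq_le _
  refine ae_eq_condExp_of_forall_setIntegral_eq hY.comap_le hSint
    (fun _ _ _ ↦ hqint.integrableOn) ?_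
    (hq.comp (comap_measurable Y)).aestronglyMeasurable
  rintro _ ⟨B, hB, rfl⟩ -
  have hleft : ∫⁻ ω in Y ⁻¹' B, ENNReal.ofReal (q (Y ω)) ∂P =
      ∫⁻ x in B, ENNReal.ofReal (g1 x) ∂ν := by
    rw [← setLIntegral_map hB (f := fun x ↦ ENNReal.ofReal (q x)) (by fun_prop) hY, hPY,
      setLIntegral_withDensity_eq_setLIntegral_mul _ (by fun_prop) (by fun_prop) hB]
    refine lintegral_congr fun x ↦ ?_
    rw [Pi.mul_apply, ← ENNReal.ofReal_mul (add_nonneg (hg0_nonneg x) (hg1_nonneg x)), mul_comm,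
      hbayes]
  rw [integral_eq_lintegral_of_nonneg_ae (ae_of_all _ fun ω ↦ hq_nonneg _)
    (hq.comp hY).aestronglyMeasurable, hleft]
  conv_rhs => rw [hSi]
  rw [integral_indicator_one hS1, Measure.real, Measure.restrict_apply hS1, Set.inter_comm,
    ← Measure.restrict_apply (hY hB), ← Measure.map_apply hY hB, h1, withDensity_apply _ hB]

lemma abs_sigmoid_sub_le (x y : ℝ) : |Real.sigmoid x - Real.sigmoid y| ≤ 1 / 4 * |x - y| := by
  refine Convex.norm_image_sub_le_of_norm_deriv_le (s := Set.univ) (f := Real.sigmoid)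
    (fun z _ ↦ differentiable_sigmoid z) (fun z _ ↦ ?_) convex_univ trivial trivial
  rw [Real.deriv_sigmoid, Real.norm_of_nonneg
    (mul_nonneg (Real.sigmoid_nonneg z) (sub_nonneg.2 (Real.sigmoid_le_one z)))]
  nlinarith [sq_nonneg (Real.sigmoid z - 1 / 2)]

/-- The log posterior-odds of two Gaussian classes is an explicit quadratic form. -/
lemma sigmoid_log_odds_gaussDensity {d : ℕ} (μ0 μ1 : Fin d → ℝ)
    {C0 C1 : Matrix (Fin d) (Fin d) ℝ} (hC0 : C0.PosDef) (hC1 : C1.PosDef) {p : ℝ}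
    (hp : p ∈ Set.Ioo (0 : ℝ) 1) (x : Fin d → ℝ) :
    Real.sigmoid (x ⬝ᵥ (((1 / 2 : ℝ) • (C0⁻¹ - C1⁻¹)) *ᵥ x) + (C1⁻¹ *ᵥ μ1 - C0⁻¹ *ᵥ μ0) ⬝ᵥ x
        + ((1 / 2) * (μ0 ⬝ᵥ (C0⁻¹ *ᵥ μ0)) - (1 / 2) * (μ1 ⬝ᵥ (C1⁻¹ *ᵥ μ1))
          + (1 / 2) * Real.log (C0.det / C1.det) + Real.log (p / (1 - p)))) *
      ((1 - p) * gaussDensity μ0 C0 x + p * gaussDensity μ1 C1 x) = p * gaussDensity μ1 C1 x := by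
  have hp0 : 0 < p := hp.1
  have hp1 : 0 < 1 - p := sub_pos.2 hp.2
  have hd0 := hC0.det_pos
  have hd1 := hC1.det_pos
  have hquad {C : Matrix (Fin d) (Fin d) ℝ} (hC : C.PosDef) (m : Fin d → ℝ) :
      (x - m) ⬝ᵥ (C⁻¹ *ᵥ (x - m)) =
        x ⬝ᵥ (C⁻¹ *ᵥ x) - 2 * ((C⁻¹ *ᵥ m) ⬝ᵥ x) + m ⬝ᵥ (C⁻¹ *ᵥ m) := by
    have hsymm : (C⁻¹)ᵀ = C⁻¹ := (isHermitian_iff_isSymm.1 hC.inv.isHermitian).eq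
    have : m ⬝ᵥ (C⁻¹ *ᵥ x) = (C⁻¹ *ᵥ m) ⬝ᵥ x := by
      rw [dotProduct_mulVec, ← mulVec_transpose, hsymm]
    simp only [mulVec_sub, dotProduct_sub, sub_dotProduct, this,
      dotProduct_comm x (C⁻¹ *ᵥ m)]
    ring
  set t := x ⬝ᵥ (((1 / 2 : ℝ) • (C0⁻¹ - C1⁻¹)) *ᵥ x) + (C1⁻¹ *ᵥ μ1 - C0⁻¹ *ᵥ μ0) ⬝ᵥ x
        + ((1 / 2) * (μ0 ⬝ᵥ (C0⁻¹ *ᵥ μ0)) - (1 / 2) * (μ1 ⬝ᵥ (C1⁻¹ *ᵥ μ1))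
          + (1 / 2) * Real.log (C0.det / C1.det) + Real.log (p / (1 - p))) with ht
  have hodds : (1 - p) * gaussDensity μ0 C0 x = Real.exp (-t) * (p * gaussDensity μ1 C1 x) := by
    have ht' : -t = -(1 / 2) * ((x - μ0) ⬝ᵥ (C0⁻¹ *ᵥ (x - μ0)))
        - -(1 / 2) * ((x - μ1) ⬝ᵥ (C1⁻¹ *ᵥ (x - μ1)))
        - (1 / 2) * Real.log (C0.det / C1.det) - Real.log (p / (1 - p)) := by
      rw [ht, hquad hC0, hquad hC1]
      simp only [smul_mulVec, sub_mulVec, dotProduct_smul, dotProduct_sub, sub_dotProduct,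
        smul_eq_mul]
      ring
    have hlog : Real.exp ((1 / 2) * Real.log (C0.det / C1.det)) = √C0.det / √C1.det := by
      rw [mul_comm, Real.exp_mul, Real.exp_log (by positivity), ← Real.sqrt_eq_rpow,
        Real.sqrt_div hd0.le]
    rw [ht', Real.exp_sub, Real.exp_sub, Real.exp_sub, hlog, Real.exp_log (by positivity)]
    simp only [gaussDensity]
    rw [Real.sqrt_mul (by positivity), Real.sqrt_mul (by positivity)]
    have := Real.sqrt_pos.2 hd0
    have := Real.sqrt_pos.2 hd1
    field_simp
  rw [hodds, Real.sigmoid_def]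
  have := Real.exp_pos (-t)
  field_simp
  ring

open scoped MatrixOrder in
/-- Adding independent noise `σ • Z` to a vector which is Gaussian on the event `S ∈ T`. -/
lemma map_cond_add_smul_eq_map_affine {Ω ι : Type*} [MeasurableSpace Ω] [MeasurableSpace ι]
    {P : Measure Ω} [IsProbabilityMeasure P] {d : ℕ} {X Z : Ω → Fin d → ℝ} {S : Ω → ι}
    (hX : Measurable X) (hZ : Measurable Z) (hS : Measurable S)
    (hZindep : IndepFun Z (fun ω ↦ (X ω, S ω)) P) (hZlaw : P.map Z = stdGaussianPi d)
    {T : Set ι} (hT : MeasurableSet T) (hPT : P (S ⁻¹' T) ≠ 0)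
    {m : Fin d → ℝ} {C B : Matrix (Fin d) (Fin d) ℝ} (hC : C.PosDef) {σ : ℝ}
    (hXlaw : P[|S ⁻¹' T].map X = volume.withDensity fun x ↦ ENNReal.ofReal (gaussDensity m C x))
    (hB : B * Bᵀ = C + σ ^ 2 • (1 : Matrix (Fin d) (Fin d) ℝ)) :
    P[|S ⁻¹' T].map (fun ω ↦ X ω + σ • Z ω) = (stdGaussianPi d).map fun y ↦ m + B *ᵥ y := by
  have : IsProbabilityMeasure P[|S ⁻¹' T] := cond_isProbabilityMeasure hPT
  obtain ⟨hXZ, hZ'⟩ := IndepFun.cond_of_prodMk hZ hS hZindep hT hPT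
  obtain ⟨B₀, rfl⟩ : ∃ B₀ : Matrix (Fin d) (Fin d) ℝ, C = B₀ * B₀ᵀ := by
    obtain ⟨D, hD⟩ := CStarAlgebra.nonneg_iff_eq_star_mul_self.1 hC.posSemidef.nonneg
    exact ⟨Dᵀ, by simpa [star_eq_conjTranspose] using hD⟩
  have hdet : B₀.det ≠ 0 := fun h ↦ hC.det_pos.ne' (by simp [h])
  exact map_add_smul_eq_map_affine_stdGaussianPi hX hZ hXZ
    (hXlaw.trans (map_affine_stdGaussianPi m hdet).symm) (hZ'.trans hZlaw) hB

/-- Residual of a quadratic form after subtracting an affine one, in coordinates in which the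
quadratic part is diagonal. -/
lemma quadratic_sub_affine_comp_affine {d : ℕ} {A B : Matrix (Fin d) (Fin d) ℝ} (hA : Aᵀ = A)
    {l : Fin d → ℝ} (hl : Bᵀ * A * B = diagonal l) (m a b y : Fin d → ℝ) (c β : ℝ) :
    (m + B *ᵥ y) ⬝ᵥ (A *ᵥ (m + B *ᵥ y)) + b ⬝ᵥ (m + B *ᵥ y) + c - (a ⬝ᵥ (m + B *ᵥ y) + β) =
      ((∑ j, l j) + b ⬝ᵥ m + m ⬝ᵥ (A *ᵥ m) + c - (a ⬝ᵥ m + β)) +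
        ∑ j, (l j * (y j ^ 2 - 1) + (Bᵀ *ᵥ (b + (2 : ℝ) • (A *ᵥ m) - a)) j * y j) := by
  have hdiag : (B *ᵥ y) ⬝ᵥ (A *ᵥ (B *ᵥ y)) = ∑ j, l j * y j ^ 2 := by
    nth_rw 1 [← vecMul_transpose]
    rw [← dotProduct_mulVec, mulVec_mulVec, mulVec_mulVec, hl]
    simp only [mulVec_diagonal, dotProduct]
    exact Finset.sum_congr rfl fun j _ ↦ by ring
  have hcross : m ⬝ᵥ (A *ᵥ (B *ᵥ y)) = (A *ᵥ m) ⬝ᵥ (B *ᵥ y) := by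
    rw [dotProduct_mulVec, ← mulVec_transpose, hA]
  have hlin : ∑ j, (Bᵀ *ᵥ (b + (2 : ℝ) • (A *ᵥ m) - a)) j * y j =
      (b + (2 : ℝ) • (A *ᵥ m) - a) ⬝ᵥ (B *ᵥ y) := by
    rw [mulVec_transpose, dotProduct_mulVec, dotProduct]
  simp only [Finset.sum_add_distrib, hlin, mul_sub, Finset.sum_sub_distrib, mul_one]
  simp only [mulVec_add, add_dotProduct, dotProduct_add, sub_dotProduct, smul_dotProduct,
    smul_eq_mul, hdiag, hcross, dotProduct_comm (B *ᵥ y) (A *ᵥ m)]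
  ring

lemma memLp_quadratic_sub_affine {d : ℕ} {A B : Matrix (Fin d) (Fin d) ℝ} (hA : Aᵀ = A)
    {l : Fin d → ℝ} (hl : Bᵀ * A * B = diagonal l) (m a b : Fin d → ℝ) (c β : ℝ) :
    MemLp (fun x ↦ x ⬝ᵥ (A *ᵥ x) + b ⬝ᵥ x + c - (a ⬝ᵥ x + β)) 2
      ((stdGaussianPi d).map fun y ↦ m + B *ᵥ y) := by
  rw [memLp_map_measure_iff (by fun_prop) (by fun_prop)]
  simp only [Function.comp_def, quadratic_sub_affine_comp_affine hA hl]
  exact memLp_sum_quadratic_pi _ _ _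

lemma integral_sq_quadratic_sub_affine {d : ℕ} {A B : Matrix (Fin d) (Fin d) ℝ} (hA : Aᵀ = A)
    {l : Fin d → ℝ} (hl : Bᵀ * A * B = diagonal l) (m a b : Fin d → ℝ) (c β : ℝ) :
    ∫ x, (x ⬝ᵥ (A *ᵥ x) + b ⬝ᵥ x + c - (a ⬝ᵥ x + β)) ^ 2
        ∂((stdGaussianPi d).map fun y ↦ m + B *ᵥ y) =
      ((∑ j, l j) + b ⬝ᵥ m + m ⬝ᵥ (A *ᵥ m) + c - (a ⬝ᵥ m + β)) ^ 2 +
        (∑ j, (2 * l j ^ 2 + (Bᵀ *ᵥ (b + (2 : ℝ) • (A *ᵥ m))) j ^ 2)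
          - 2 * (((B * Bᵀ) *ᵥ (b + (2 : ℝ) • (A *ᵥ m))) ⬝ᵥ a) + a ⬝ᵥ ((B * Bᵀ) *ᵥ a)) := by
  rw [integral_map (by fun_prop) (by fun_prop)]
  simp only [quadratic_sub_affine_comp_affine hA hl, integral_sq_sum_quadratic_pi]
  have hB (v w : Fin d → ℝ) : ((B * Bᵀ) *ᵥ v) ⬝ᵥ w = ∑ j, (Bᵀ *ᵥ v) j * (Bᵀ *ᵥ w) j := by
    rw [← mulVec_mulVec, dotProduct_comm, dotProduct_mulVec, ← mulVec_transpose, dotProduct_comm,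
      dotProduct]
  rw [hB, dotProduct_comm a ((B * Bᵀ) *ᵥ a), hB, Finset.mul_sum, ← Finset.sum_sub_distrib,
    ← Finset.sum_add_distrib]
  congr 1
  refine Finset.sum_congr rfl fun j _ ↦ ?_
  rw [mulVec_sub, Pi.sub_apply]
  ring

lemma vecMul_eq_mulVec_of_transpose_eq {d : ℕ} {M : Matrix (Fin d) (Fin d) ℝ} (hM : Mᵀ = M)
    (v : Fin d → ℝ) : v ᵥ* M = M *ᵥ v := by
  rw [← mulVec_transpose, hM]

/-- The variance explained by the best affine approximation, for a two-component mixture. -/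
lemma mixture_explained_variance {d : ℕ} {C0 C1 V : Matrix (Fin d) (Fin d) ℝ}
    {D v0 v1 w a : Fin d → ℝ} {p k : ℝ}
    (hV : V = p • C1 + (1 - p) • C0 + (p * (1 - p)) • vecMulVec D D) (ha : V *ᵥ a = w)
    (hw : w = p • (C1 *ᵥ v1) + (1 - p) • (C0 *ᵥ v0) + (p * (1 - p) * k) • D) :
    p * (a ⬝ᵥ (C1 *ᵥ a) - 2 * ((C1 *ᵥ v1) ⬝ᵥ a)) + (1 - p) * (a ⬝ᵥ (C0 *ᵥ a)
      - 2 * ((C0 *ᵥ v0) ⬝ᵥ a)) + p * (1 - p) * ((k - a ⬝ᵥ D) ^ 2 - k ^ 2) = -(w ⬝ᵥ a) := by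
  have h1 : a ⬝ᵥ w = p * (a ⬝ᵥ (C1 *ᵥ a)) + (1 - p) * (a ⬝ᵥ (C0 *ᵥ a))
      + p * (1 - p) * (a ⬝ᵥ D) ^ 2 := by
    rw [← ha, hV]
    simp only [add_mulVec, smul_mulVec, dotProduct_add, dotProduct_smul, smul_eq_mul,
      vecMulVec_mulVec, op_smul_eq_smul, dotProduct_comm D a]
    ring
  have h2 : w ⬝ᵥ a = p * ((C1 *ᵥ v1) ⬝ᵥ a) + (1 - p) * ((C0 *ᵥ v0) ⬝ᵥ a)
      + p * (1 - p) * k * (a ⬝ᵥ D) := by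
    rw [hw]
    simp only [add_dotProduct, smul_dotProduct, smul_eq_mul, dotProduct_comm D a]
  rw [dotProduct_comm] at h1
  linear_combination 2 * h2 - h1

/-- Class-conditional vector Gaussian bound (Theorem 4 of the paper):
for class-conditional Gaussians with distinct covariances, the approximation error of the
sigmoid-composed-with-affine hypothesis class satisfies
`ε_A ≤ (1/4)(VAR₁ − COV · VAR₂⁻¹ · COVᵀ)`. -/
theorem epsA_bound_class_conditional_gaussian
    {Ω : Type*} [MeasurableSpace Ω] (μ : Measure Ω) [IsProbabilityMeasure μ]
    {d : ℕ}
    (X : Ω → (Fin d → ℝ)) (S : Ω → ℝ) (Z : Ω → (Fin d → ℝ))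
    (hX : Measurable X) (hS : Measurable S) (hZ : Measurable Z)
    (p : ℝ) (hp : p ∈ Set.Ioo (0 : ℝ) 1)
    (hS01 : ∀ ω, S ω = 0 ∨ S ω = 1)
    (hSlaw : μ {ω | S ω = 1} = ENNReal.ofReal p)
    -- conditional law of X given S = s is N(μ_s, Σ_s), Σ_s positive definite
    (μ0 μ1 : Fin d → ℝ) (Cv0 Cv1 : Matrix (Fin d) (Fin d) ℝ)
    (hCv0 : Cv0.PosDef) (hCv1 : Cv1.PosDef)
    (hX0 : Measure.map X (μ[|{ω | S ω = 0}])
      = volume.withDensity fun x => ENNReal.ofReal (gaussDensity μ0 Cv0 x))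
    (hX1 : Measure.map X (μ[|{ω | S ω = 1}])
      = volume.withDensity fun x => ENNReal.ofReal (gaussDensity μ1 Cv1 x))
    (σ : ℝ) (hσ : 0 < σ)
    (hZlaw : Measure.map Z μ = Measure.pi fun _ : Fin d => gaussianReal 0 1)
    (hZindep : IndepFun Z (fun ω => (X ω, S ω)) μ)
    (Xσ : Ω → (Fin d → ℝ)) (hXσ : Xσ = fun ω => X ω + σ • Z ω)
    -- Σ̃_s := Σ_s + σ²I
    (St0 St1 : Matrix (Fin d) (Fin d) ℝ)
    (hSt0 : St0 = Cv0 + σ ^ 2 • (1 : Matrix (Fin d) (Fin d) ℝ))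
    (hSt1 : St1 = Cv1 + σ ^ 2 • (1 : Matrix (Fin d) (Fin d) ℝ))
    -- A, b, c: coefficients of the quadratic log posterior-odds
    (A : Matrix (Fin d) (Fin d) ℝ) (hA : A = (1 / 2 : ℝ) • (St0⁻¹ - St1⁻¹))
    (b : Fin d → ℝ) (hb : b = St1⁻¹ *ᵥ μ1 - St0⁻¹ *ᵥ μ0)
    (c : ℝ) (hc : c = (1 / 2) * (μ0 ⬝ᵥ (St0⁻¹ *ᵥ μ0)) - (1 / 2) * (μ1 ⬝ᵥ (St1⁻¹ *ᵥ μ1))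
      + (1 / 2) * Real.log (St0.det / St1.det) + Real.log (p / (1 - p)))
    -- Σ̃_s^{1/2}: the positive-semidefinite square roots
    (R0 R1 : Matrix (Fin d) (Fin d) ℝ)
    (hR0 : R0.PosSemidef) (hR0sq : R0 * R0 = St0)
    (hR1 : R1.PosSemidef) (hR1sq : R1 * R1 = St1)
    -- spectral data: Q_sᵀ Σ̃_s^{1/2} A Σ̃_s^{1/2} Q_s = diag(λ^{(s)}), Q_s orthogonal
    (lam0 lam1 : Fin d → ℝ) (Q0 Q1 : Matrix (Fin d) (Fin d) ℝ)
    (hQ0 : Q0ᵀ * Q0 = 1) (hQ1 : Q1ᵀ * Q1 = 1)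
    (hdiag0 : Q0ᵀ * (R0 * A * R0) * Q0 = Matrix.diagonal lam0)
    (hdiag1 : Q1ᵀ * (R1 * A * R1) * Q1 = Matrix.diagonal lam1)
    -- u^{(s)} := Q_sᵀ Σ̃_s^{1/2}(b + 2Aμ_s)
    (u0 u1 : Fin d → ℝ)
    (hu0 : u0 = Q0ᵀ *ᵥ (R0 *ᵥ (b + (2 : ℝ) • (A *ᵥ μ0))))
    (hu1 : u1 = Q1ᵀ *ᵥ (R1 *ᵥ (b + (2 : ℝ) • (A *ᵥ μ1))))
    -- M_s and V_s
    (M0 M1 V0 V1 : ℝ)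
    (hM0 : M0 = (∑ j, lam0 j) + b ⬝ᵥ μ0 + μ0 ⬝ᵥ (A *ᵥ μ0) + c)
    (hM1 : M1 = (∑ j, lam1 j) + b ⬝ᵥ μ1 + μ1 ⬝ᵥ (A *ᵥ μ1) + c)
    (hV0 : V0 = ∑ j, (2 * lam0 j ^ 2 + u0 j ^ 2))
    (hV1 : V1 = ∑ j, (2 * lam1 j ^ 2 + u1 j ^ 2))
    -- VAR₁, COV and VAR₂
    (VAR1 : ℝ) (hVAR1 : VAR1 = p * V1 + (1 - p) * V0 + p * (1 - p) * (M1 - M0) ^ 2)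
    (COV : Fin d → ℝ)
    (hCOV : COV = fun j =>
      2 * p * (((μ1 ᵥ* A) ᵥ* Cv1) j)
        + 2 * (1 - p) * (((μ0 ᵥ* A) ᵥ* Cv0) j)
        + 2 * σ ^ 2 * (((p • μ1 + (1 - p) • μ0) ᵥ* A) j)
        + p * (1 - p) * ((A * (Cv1 - Cv0)).trace
            + μ1 ⬝ᵥ (A *ᵥ μ1) - μ0 ⬝ᵥ (A *ᵥ μ0)) * ((μ1 - μ0) j)
        + (b ᵥ* (p • Cv1 + (1 - p) • Cv0 + σ ^ 2 • (1 : Matrix (Fin d) (Fin d) ℝ)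
            + (p * (1 - p)) • vecMulVec (μ1 - μ0) (μ1 - μ0))) j)
    (VAR2 : Matrix (Fin d) (Fin d) ℝ)
    (hVAR2 : VAR2 = p • Cv1 + (1 - p) • Cv0
      + (p * (1 - p)) • vecMulVec (μ1 - μ0) (μ1 - μ0)
      + σ ^ 2 • (1 : Matrix (Fin d) (Fin d) ℝ))
    -- η^σ, a measurable version of the conditional expectation E[S | X^σ]
    (η : (Fin d → ℝ) → ℝ) (hη : Measurable η)
    (hηcond : (fun ω => η (Xσ ω)) =ᵐ[μ] μ[S | MeasurableSpace.comap Xσ inferInstance]) :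
    (⨅ ab : (Fin d → ℝ) × ℝ,
        ∫ ω, (η (Xσ ω) - 1 / (1 + Real.exp (-(ab.1 ⬝ᵥ Xσ ω + ab.2)))) ^ 2 ∂μ)
      ≤ (1 / 4) * (VAR1 - COV ⬝ᵥ (VAR2⁻¹ *ᵥ COV)) := by
  obtain ⟨hp0, hp1⟩ := hp
  have hp1' : 0 < 1 - p := sub_pos.2 hp1
  have hXσ_meas : Measurable Xσ := by rw [hXσ]; fun_prop
  have hS1_meas : MeasurableSet {ω | S ω = 1} := hS (measurableSet_singleton 1)
  have hScompl : {ω | S ω = 1}ᶜ = {ω | S ω = 0} := by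
    ext ω
    rcases hS01 ω with h | h <;> simp [h]
  have hS0law : μ {ω | S ω = 0} = ENNReal.ofReal (1 - p) := by
    rw [← hScompl, prob_compl_eq_one_sub hS1_meas, hSlaw, ENNReal.ofReal_sub _ hp0.le,
      ENNReal.ofReal_one]
  have hScale : (σ ^ 2 • (1 : Matrix (Fin d) (Fin d) ℝ)).PosDef :=
    PosDef.one.smul (by positivity)
  have hSt0_pos : St0.PosDef := hSt0 ▸ hCv0.add hScale
  have hSt1_pos : St1.PosDef := hSt1 ▸ hCv1.add hScale
  have symm_of {M : Matrix (Fin d) (Fin d) ℝ} (hM : M.IsHermitian) : Mᵀ = M :=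
    (isHermitian_iff_isSymm.1 hM).eq
  have hAsymm : Aᵀ = A := by
    rw [hA, transpose_smul, transpose_sub, symm_of hSt0_pos.inv.isHermitian,
      symm_of hSt1_pos.inv.isHermitian]
  have factor {R Q St : Matrix (Fin d) (Fin d) ℝ} (hR : R.PosSemidef) (hQ : Qᵀ * Q = 1)
      (hRsq : R * R = St) : (R * Q) * (R * Q)ᵀ = St := by
    rw [transpose_mul, symm_of hR.isHermitian, mul_assoc, ← mul_assoc Q,
      mul_eq_one_comm.1 hQ, one_mul, hRsq]
  have hB0 := factor hR0 hQ0 hR0sq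
  have hB1 := factor hR1 hQ1 hR1sq
  have diag {R Q : Matrix (Fin d) (Fin d) ℝ} {l : Fin d → ℝ} (hR : R.PosSemidef)
      (h : Qᵀ * (R * A * R) * Q = diagonal l) : (R * Q)ᵀ * A * (R * Q) = diagonal l := by
    rw [← h, transpose_mul, symm_of hR.isHermitian]
    simp only [mul_assoc]
  have hl0 := diag hR0 hdiag0
  have hl1 := diag hR1 hdiag1
  have coord {R Q : Matrix (Fin d) (Fin d) ℝ} (hR : R.PosSemidef) (v : Fin d → ℝ) :
      Qᵀ *ᵥ (R *ᵥ v) = (R * Q)ᵀ *ᵥ v := by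
    rw [transpose_mul, symm_of hR.isHermitian, mulVec_mulVec]
  rw [coord hR0] at hu0
  rw [coord hR1] at hu1
  have hlaw0 : (μ[|{ω | S ω = 0}]).map Xσ = (stdGaussianPi d).map fun y ↦ μ0 + (R0 * Q0) *ᵥ y := by
    rw [hXσ]
    exact map_cond_add_smul_eq_map_affine hX hZ hS hZindep hZlaw (measurableSet_singleton 0)
      (hS0law.trans_ne (ENNReal.ofReal_pos.2 hp1').ne') hCv0 hX0 (hB0.trans hSt0)
  have hlaw1 : (μ[|{ω | S ω = 1}]).map Xσ = (stdGaussianPi d).map fun y ↦ μ1 + (R1 * Q1) *ᵥ y := by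
    rw [hXσ]
    exact map_cond_add_smul_eq_map_affine hX hZ hS hZindep hZlaw (measurableSet_singleton 1)
      (hSlaw.trans_ne (ENNReal.ofReal_pos.2 hp0).ne') hCv1 hX1 (hB1.trans hSt1)
  have hrestrict {s r : ℝ} (hr : 0 < r) (hs : μ {ω | S ω = s} = ENNReal.ofReal r) :
      (μ.restrict {ω | S ω = s}).map Xσ =
        ENNReal.ofReal r • (μ[|{ω | S ω = s}]).map Xσ := by
    rw [ProbabilityTheory.cond, Measure.map_smul, smul_smul, hs,
      ENNReal.mul_inv_cancel (ENNReal.ofReal_pos.2 hr).ne' ENNReal.ofReal_ne_top, one_smul]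
  have hdens {s r : ℝ} (hr : 0 < r) (hs : μ {ω | S ω = s} = ENNReal.ofReal r)
      {m : Fin d → ℝ} {B St : Matrix (Fin d) (Fin d) ℝ} (hSt : St.PosDef) (hB : B * Bᵀ = St)
      (hlaw : (μ[|{ω | S ω = s}]).map Xσ = (stdGaussianPi d).map fun y ↦ m + B *ᵥ y) :
      (μ.restrict {ω | S ω = s}).map Xσ =
        volume.withDensity fun x ↦ ENNReal.ofReal (r * gaussDensity m St x) := by
    have hdet : B.det ≠ 0 := fun h ↦ hSt.det_pos.ne' (by simp [← hB, h])
    rw [hrestrict hr hs, hlaw, map_affine_stdGaussianPi m hdet, hB,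
      ← withDensity_smul _ (by have := measurable_gaussDensity m St; fun_prop)]
    simp only [ENNReal.ofReal_mul hr.le]
    rfl
  have hmix : μ.map Xσ =
      ENNReal.ofReal p • ((stdGaussianPi d).map fun y ↦ μ1 + (R1 * Q1) *ᵥ y) +
        ENNReal.ofReal (1 - p) • (stdGaussianPi d).map fun y ↦ μ0 + (R0 * Q0) *ᵥ y := by
    rw [← hlaw0, ← hlaw1, ← hrestrict hp0 hSlaw, ← hrestrict hp1' hS0law,
      ← Measure.map_add _ _ hXσ_meas, ← hScompl, Measure.restrict_add_restrict_compl hS1_meas]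
  have hdensity_nonneg (m : Fin d → ℝ) (C : Matrix (Fin d) (Fin d) ℝ) (x : Fin d → ℝ) :
      0 ≤ gaussDensity m C x := by
    unfold gaussDensity; positivity
  set θ : (Fin d → ℝ) → ℝ := fun x ↦ x ⬝ᵥ (A *ᵥ x) + b ⬝ᵥ x + c with hθ
  have hθ_meas : Measurable θ := by fun_prop
  have hη_eq : (fun ω ↦ η (Xσ ω)) =ᵐ[μ] fun ω ↦ Real.sigmoid (θ (Xσ ω)) := by
    refine hηcond.trans (posterior_ae_eq_condExp (ν := volume) hXσ_meas hS hS01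
      ((measurable_gaussDensity μ0 St0).const_mul (1 - p))
      ((measurable_gaussDensity μ1 St1).const_mul p)
      (q := fun x ↦ Real.sigmoid (θ x)) (by fun_prop)
      (fun x ↦ mul_nonneg hp1'.le (hdensity_nonneg _ _ x))
      (fun x ↦ mul_nonneg hp0.le (hdensity_nonneg _ _ x)) (fun _ ↦ Real.sigmoid_nonneg _)
      (fun _ ↦ Real.sigmoid_le_one _) (hdens hp1' hS0law hSt0_pos hB0 hlaw0)
      (hdens hp0 hSlaw hSt1_pos hB1 hlaw1) fun x ↦ ?_).symm
    rw [hθ, hA, hb, hc]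
    exact sigmoid_log_odds_gaussDensity μ0 μ1 hSt0_pos hSt1_pos ⟨hp0, hp1⟩ x
  have hVAR2' : VAR2 = p • St1 + (1 - p) • St0
      + (p * (1 - p)) • vecMulVec (μ1 - μ0) (μ1 - μ0) := by
    rw [hVAR2, hSt0, hSt1]
    module
  have hVAR2_pos : VAR2.PosDef := by
    rw [hVAR2']
    refine ((hSt1_pos.smul hp0).add (hSt0_pos.smul hp1')).add_posSemidef
      (PosSemidef.smul ?_ (mul_pos hp0 hp1').le)
    simpa using posSemidef_vecMulVec_self_star (μ1 - μ0)
  have trace_eq {B St : Matrix (Fin d) (Fin d) ℝ} {l : Fin d → ℝ} (hB : B * Bᵀ = St)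
      (hl : Bᵀ * A * B = diagonal l) : ∑ j, l j = (A * St).trace := by
    rw [← trace_diagonal, ← hl, mul_assoc, trace_mul_comm, mul_assoc, hB]
  have hM_sub : M1 - M0 = (A * (Cv1 - Cv0)).trace + μ1 ⬝ᵥ (A *ᵥ μ1) - μ0 ⬝ᵥ (A *ᵥ μ0)
      + b ⬝ᵥ (μ1 - μ0) := by
    have : Cv1 - Cv0 = St1 - St0 := by rw [hSt0, hSt1]; abel
    rw [hM0, hM1, trace_eq hB0 hl0, trace_eq hB1 hl1, this, mul_sub, trace_sub, dotProduct_sub]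
    ring
  have hCOV' : COV = p • (St1 *ᵥ (b + (2 : ℝ) • (A *ᵥ μ1)))
      + (1 - p) • (St0 *ᵥ (b + (2 : ℝ) • (A *ᵥ μ0)))
      + (p * (1 - p) * (M1 - M0)) • (μ1 - μ0) := by
    rw [hCOV, hM_sub, hSt0, hSt1]
    ext j
    simp only [vecMul_eq_mulVec_of_transpose_eq hAsymm, vecMul_add, vecMul_smul, vecMul_one,
      vecMul_eq_mulVec_of_transpose_eq (symm_of hCv0.isHermitian),
      vecMul_eq_mulVec_of_transpose_eq (symm_of hCv1.isHermitian), vecMul_vecMulVec,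
      add_mulVec, smul_mulVec, one_mulVec, mulVec_add, mulVec_smul, Pi.add_apply, Pi.smul_apply,
      smul_eq_mul]
    ring
  set a := VAR2⁻¹ *ᵥ COV with ha
  have hVAR2a : VAR2 *ᵥ a = COV := by
    rw [ha, mulVec_mulVec, mul_nonsing_inv _ hVAR2_pos.det_pos.ne'.isUnit, one_mulVec]
  set β := p * (M1 - a ⬝ᵥ μ1) + (1 - p) * (M0 - a ⬝ᵥ μ0) with hβ
  have hmem (m : Fin d → ℝ) {B : Matrix (Fin d) (Fin d) ℝ} {l : Fin d → ℝ}
      (hl : Bᵀ * A * B = diagonal l) :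
      Integrable (fun x ↦ (θ x - (a ⬝ᵥ x + β)) ^ 2)
        ((stdGaussianPi d).map fun y ↦ m + B *ᵥ y) :=
    (memLp_quadratic_sub_affine hAsymm hl m a b c β).integrable_sq
  have h_int1 := (hmem μ1 hl1).smul_measure (c := ENNReal.ofReal p) ENNReal.ofReal_ne_top
  have h_int0 := (hmem μ0 hl0).smul_measure (c := ENNReal.ofReal (1 - p)) ENNReal.ofReal_ne_top
  have h_int : Integrable (fun ω ↦ (θ (Xσ ω) - (a ⬝ᵥ Xσ ω + β)) ^ 2) μ := by
    refine Integrable.comp_measurable (g := fun x ↦ (θ x - (a ⬝ᵥ x + β)) ^ 2) ?_ hXσ_meas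
    rw [hmix]
    exact h_int1.add_measure h_int0
  have hresidual : ∫ ω, (θ (Xσ ω) - (a ⬝ᵥ Xσ ω + β)) ^ 2 ∂μ = VAR1 - COV ⬝ᵥ a := by
    rw [← integral_map (f := fun x ↦ (θ x - (a ⬝ᵥ x + β)) ^ 2) hXσ_meas.aemeasurable
      (by fun_prop), hmix, integral_add_measure h_int1 h_int0, integral_smul_measure,
      integral_smul_measure, integral_sq_quadratic_sub_affine hAsymm hl0,
      integral_sq_quadratic_sub_affine hAsymm hl1, ENNReal.toReal_ofReal hp0.le,
      ENNReal.toReal_ofReal hp1'.le, hB0, hB1, ← hu0, ← hu1, ← hV0, ← hV1, ← hM0, ← hM1,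
      hVAR1]
    have := mixture_explained_variance hVAR2' hVAR2a hCOV'
    rw [dotProduct_sub] at this
    simp only [smul_eq_mul, hβ]
    linear_combination this
  calc _ ≤ ∫ ω, (η (Xσ ω) - 1 / (1 + Real.exp (-(a ⬝ᵥ Xσ ω + β)))) ^ 2 ∂μ :=
        ciInf_le (f := fun ab : (Fin d → ℝ) × ℝ ↦
          ∫ ω, (η (Xσ ω) - 1 / (1 + Real.exp (-(ab.1 ⬝ᵥ Xσ ω + ab.2)))) ^ 2 ∂μ)
          ⟨0, by rintro _ ⟨ab, rfl⟩; exact integral_nonneg fun ω ↦ sq_nonneg _⟩ (a, β)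
    _ ≤ ∫ ω, (1 / 4) * (θ (Xσ ω) - (a ⬝ᵥ Xσ ω + β)) ^ 2 ∂μ := by
        refine integral_mono_of_nonneg (ae_of_all _ fun ω ↦ sq_nonneg _) (h_int.const_mul _) ?_
        filter_upwards [hη_eq] with ω hω
        have hlip := abs_sigmoid_sub_le (θ (Xσ ω)) (a ⬝ᵥ Xσ ω + β)
        have hsq := pow_le_pow_left₀ (abs_nonneg _) hlip 2
        rw [sq_abs, mul_pow, sq_abs] at hsq
        rw [hω, one_div, ← Real.sigmoid_def]
        linarith [sq_nonneg (θ (Xσ ω) - (a ⬝ᵥ Xσ ω + β))]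
    _ = _ := by rw [integral_const_mul, hresidual]
end

section
/- Let S ~ Bernoulli(p) with p ∈ (0,1) and p̄ := 1 − p, suppose the conditional distribution of X given S = s is N(μ_s, σ_s² I_d) for s ∈ {0,1} with μ_s ∈ ℝ^d and σ_s > 0, let σ > 0, and let X^σ := X + σZ with Z ~ N(0, I_d) independent of (X, S). Let θ^σ be the log posterior-odds function θ^σ(x) = log(p f_1^σ(x)/(p̄ f_0^σ(x))), where f_s^σ is the N(μ_s, (σ_s² + σ²)I) density, and write a := (σ_1² − σ_0²)/(2(σ_1² + σ²)(σ_0² + σ²)), b := ((σ_0² + σ²)μ_1 − (σ_1² + σ²)μ_0)/((σ_1² + σ²)(σ_0² + σ²)), c := (1/2)(σ_0² + σ²)⁻¹‖μ_0‖² − (1/2)(σ_1² + σ²)⁻¹‖μ_1‖² + (d/2)log((σ_0² + σ²)/(σ_1² + σ²)) + log(p/p̄). Then the conditional means and variances of θ^σ(X^σ) given S are: E[θ^σ(X^σ) | S = 0] = (d/2)(σ_1² − σ_0²)/(σ_1² + σ²) + c + [2(σ_0² + σ²)μ_1ᵀμ_0 − (σ_1² + σ_0² + 2σ²)‖μ_0‖²]/(2(σ_1²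 + σ²)(σ_0² + σ²)); E[θ^σ(X^σ) | S = 1] = (d/2)(σ_1² − σ_0²)/(σ_0² + σ²) + c + [(σ_1² + σ_0² + 2σ²)‖μ_1‖² − 2(σ_1² + σ²)μ_1ᵀμ_0]/(2(σ_1² + σ²)(σ_0² + σ²)); Var(θ^σ(X^σ) | S = 0) = [d(σ_1² − σ_0²)² + 2(σ_0² + σ²)‖μ_1 − μ_0‖²]/(2(σ_1² + σ²)²); and Var(θ^σ(X^σ) | S = 1) = [d(σ_1² − σ_0²)² + 2(σ_1² + σ²)‖μ_1 − μ_0‖²]/(2(σ_0² + σ²)²). -/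
open MeasureTheory ProbabilityTheory Matrix

open scoped NNReal

lemma integrable_pow_gaussianReal (m : ℝ) (v : ℝ≥0) (n : ℕ) :
    Integrable (fun t : ℝ => t ^ n) (gaussianReal m v) := by
  have h := (memLp_id_gaussianReal' (μ := m) (v := v) n (by simp)).integrable_norm_pow'
  rw [← integrable_norm_iff (by fun_prop)]
  simpa using h

lemma hasDerivAt_mul_exp_sq (v : ℝ) {q : ℝ → ℝ} {q' t : ℝ} (hq : HasDerivAt q q' t) :
    HasDerivAt (fun t => q t * Real.exp (v * t ^ 2 / 2))
      ((q' + v * t * q t) * Real.exp (v * t ^ 2 / 2)) t := by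
  have h : HasDerivAt (fun t : ℝ => v * t ^ 2 / 2) (v * t) t :=
    (((hasDerivAt_pow 2 t).const_mul v).div_const 2).congr_deriv (by norm_num; ring)
  exact (hq.mul h.exp).congr_deriv (by ring)

lemma iteratedDeriv_exp_sq (v : ℝ) :
    iteratedDeriv 3 (fun t => Real.exp (v * t ^ 2 / 2)) =
        (fun t => (3 * v ^ 2 * t + v ^ 3 * t ^ 3) * Real.exp (v * t ^ 2 / 2)) ∧
      iteratedDeriv 4 (fun t => Real.exp (v * t ^ 2 / 2)) =
        (fun t => (3 * v ^ 2 + 6 * v ^ 3 * t ^ 2 + v ^ 4 * t ^ 4) *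
          Real.exp (v * t ^ 2 / 2)) := by
  have h1 : deriv (fun t => Real.exp (v * t ^ 2 / 2)) =
      fun t => v * t * Real.exp (v * t ^ 2 / 2) := by
    ext t
    have := (hasDerivAt_mul_exp_sq v (hasDerivAt_const t (1 : ℝ))).deriv
    simpa using this
  have h2 : deriv (fun t => v * t * Real.exp (v * t ^ 2 / 2)) =
      fun t => (v + v ^ 2 * t ^ 2) * Real.exp (v * t ^ 2 / 2) := by
    ext t
    rw [(hasDerivAt_mul_exp_sq v ((hasDerivAt_id' t).const_mul v)).deriv]
    ring
  have h3 : deriv (fun t => (v + v ^ 2 * t ^ 2) * Real.exp (v * t ^ 2 / 2)) =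
      fun t => (3 * v ^ 2 * t + v ^ 3 * t ^ 3) * Real.exp (v * t ^ 2 / 2) := by
    ext t
    rw [(hasDerivAt_mul_exp_sq v (((hasDerivAt_pow 2 t).const_mul (v ^ 2)).const_add v)).deriv]
    norm_num
    ring
  have h4 : deriv (fun t => (3 * v ^ 2 * t + v ^ 3 * t ^ 3) * Real.exp (v * t ^ 2 / 2)) =
      fun t => (3 * v ^ 2 + 6 * v ^ 3 * t ^ 2 + v ^ 4 * t ^ 4) * Real.exp (v * t ^ 2 / 2) := by
    ext t
    rw [(hasDerivAt_mul_exp_sq v (((hasDerivAt_id' t).const_mul (3 * v ^ 2)).fun_add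
      ((hasDerivAt_pow 3 t).const_mul (v ^ 3)))).deriv]
    norm_num
    ring
  have h3' : iteratedDeriv 3 (fun t => Real.exp (v * t ^ 2 / 2)) =
      (fun t => (3 * v ^ 2 * t + v ^ 3 * t ^ 3) * Real.exp (v * t ^ 2 / 2)) := by
    rw [iteratedDeriv_succ, iteratedDeriv_succ, iteratedDeriv_one, h1, h2, h3]
  exact ⟨h3', by rw [iteratedDeriv_succ, h3', h4]⟩

lemma integral_pow_eq_iteratedDeriv_exp_sq (v : ℝ≥0) (n : ℕ) :
    ∫ t, t ^ n ∂(gaussianReal 0 v) =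
      iteratedDeriv n (fun t : ℝ => Real.exp (v * t ^ 2 / 2)) 0 := by
  have h := iteratedDeriv_mgf_zero (X := fun t : ℝ => t) (μ := gaussianReal 0 v)
    (by simp) n
  rw [mgf_fun_id_gaussianReal] at h
  simpa using h.symm

lemma integral_sq_gaussianReal_zero (v : ℝ≥0) : ∫ t, t ^ 2 ∂(gaussianReal 0 v) = v := by
  have h := variance_fun_id_gaussianReal (μ := 0) (v := v)
  rw [variance_eq_integral measurable_id'.aemeasurable] at h
  simpa using h

lemma integral_pow_three_gaussianReal_zero (v : ℝ≥0) :
    ∫ t, t ^ 3 ∂(gaussianReal 0 v) = 0 := by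
  rw [integral_pow_eq_iteratedDeriv_exp_sq, (iteratedDeriv_exp_sq v).1]
  simp

lemma integral_pow_four_gaussianReal_zero (v : ℝ≥0) :
    ∫ t, t ^ 4 ∂(gaussianReal 0 v) = 3 * (v : ℝ) ^ 2 := by
  rw [integral_pow_eq_iteratedDeriv_exp_sq, (iteratedDeriv_exp_sq v).2]
  simp

lemma integral_quartic_gaussianReal_zero (v : ℝ≥0) (c₀ c₁ c₂ c₃ c₄ : ℝ) :
    ∫ t, (c₀ + c₁ * t + c₂ * t ^ 2 + c₃ * t ^ 3 + c₄ * t ^ 4) ∂(gaussianReal 0 v) =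
      c₀ + c₂ * v + c₄ * (3 * (v : ℝ) ^ 2) := by
  have h (n : ℕ) (c : ℝ) : Integrable (fun t : ℝ => c * t ^ n) (gaussianReal 0 v) :=
    (integrable_pow_gaussianReal 0 v n).const_mul c
  have h0 : Integrable (fun _ : ℝ => c₀) (gaussianReal 0 v) := integrable_const _
  have h1 : Integrable (fun t : ℝ => c₁ * t) (gaussianReal 0 v) := by simpa using h 1 c₁
  have h1_zero : ∫ t, c₁ * t ∂(gaussianReal 0 v) = 0 := by
    rw [integral_const_mul, integral_id_gaussianReal, mul_zero]
  rw [integral_add (by fun_prop) (h 4 c₄), integral_add (by fun_prop) (h 3 c₃),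
    integral_add (by fun_prop) (h 2 c₂), integral_add h0 h1]
  simp only [integral_const_mul, integral_sq_gaussianReal_zero,
    integral_pow_three_gaussianReal_zero, integral_pow_four_gaussianReal_zero,
    h1_zero]
  simp

lemma integral_gaussianReal_eq_centered (m : ℝ) (v : ℝ≥0) {f : ℝ → ℝ} (hf : Measurable f) :
    ∫ t, f t ∂(gaussianReal m v) = ∫ t, f (t + m) ∂(gaussianReal 0 v) := by
  have h := gaussianReal_map_add_const (μ := 0) (v := v) m
  rw [zero_add] at h
  rw [← h, integral_map (by fun_prop) (hf.aestronglyMeasurable)]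

lemma memLp_two_quadratic_gaussianReal (m : ℝ) (v : ℝ≥0) (A B : ℝ) :
    MemLp (fun t : ℝ => A * t ^ 2 + B * t) 2 (gaussianReal m v) := by
  rw [memLp_two_iff_integrable_sq (by fun_prop)]
  have h (n : ℕ) (c : ℝ) : Integrable (fun t : ℝ => c * t ^ n) (gaussianReal m v) :=
    (integrable_pow_gaussianReal m v n).const_mul c
  refine (((h 4 (A ^ 2)).add (h 3 (2 * A * B))).add (h 2 (B ^ 2))).congr (ae_of_all _ fun t => ?_)
  simp only [Pi.add_apply]
  ring

lemma integral_quadratic_gaussianReal_s17 (m : ℝ) (v : ℝ≥0) (A B : ℝ) :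
    ∫ t, (A * t ^ 2 + B * t) ∂(gaussianReal m v) = A * (v + m ^ 2) + B * m := by
  rw [integral_gaussianReal_eq_centered m v (by fun_prop)]
  convert integral_quartic_gaussianReal_zero v (A * m ^ 2 + B * m) (2 * A * m + B) A 0 0 using 1
  · congr with t
    ring
  · ring

lemma variance_quadratic_gaussianReal_s17 (m : ℝ) (v : ℝ≥0) (A B : ℝ) :
    Var[fun t => A * t ^ 2 + B * t; gaussianReal m v] =
      2 * A ^ 2 * v ^ 2 + v * (2 * A * m + B) ^ 2 := by
  rw [variance_eq_integral (by fun_prop), integral_quadratic_gaussianReal_s17,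
    integral_gaussianReal_eq_centered m v (by fun_prop)]
  convert integral_quartic_gaussianReal_zero v (A ^ 2 * v ^ 2) (-2 * A * v * (2 * A * m + B))
    ((2 * A * m + B) ^ 2 - 2 * A ^ 2 * v) (2 * A * (2 * A * m + B)) (A ^ 2) using 1
  · congr with t
    ring
  · ring

/-- Mean and variance of a separable quadratic function of an isotropic Gaussian vector. -/
lemma moments_quadratic_pi_gaussianReal {Ω ι : Type*} [MeasurableSpace Ω] [Fintype ι]
    {ν : Measure Ω} {Y : Ω → ι → ℝ} (hY : Measurable Y) (m : ι → ℝ) (v : ℝ≥0)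
    (hlaw : ν.map Y = Measure.pi fun i => gaussianReal (m i) v) (A : ℝ) (B : ι → ℝ) (c : ℝ) :
    (∫ ω, (A * (Y ω ⬝ᵥ Y ω) + B ⬝ᵥ Y ω + c) ∂ν =
        A * (Fintype.card ι * v + m ⬝ᵥ m) + B ⬝ᵥ m + c) ∧
      Var[fun ω => A * (Y ω ⬝ᵥ Y ω) + B ⬝ᵥ Y ω + c; ν] =
        2 * A ^ 2 * Fintype.card ι * v ^ 2 +
          v * (((2 * A) • m + B) ⬝ᵥ ((2 * A) • m + B)) := by
  set P : Measure (ι → ℝ) := Measure.pi fun i => gaussianReal (m i) v with hP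
  set g : ι → ℝ → ℝ := fun i t => A * t ^ 2 + B i * t with hg
  have hmem (i : ι) : MemLp (g i) 2 (gaussianReal (m i) v) :=
    memLp_two_quadratic_gaussianReal _ _ _ _
  have hq (x : ι → ℝ) : A * (x ⬝ᵥ x) + B ⬝ᵥ x + c = (∑ i, g i (x i)) + c := by
    simp only [hg, dotProduct, Finset.sum_add_distrib, Finset.mul_sum]
    congr 2
    exact Finset.sum_congr rfl fun i _ => by ring
  have hgm : Measurable fun x : ι → ℝ => (∑ i, g i (x i)) + c := by
    simp only [hg]
    fun_prop
  have hgs : Measurable fun x : ι → ℝ => ∑ i, g i (x i) := by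
    simp only [hg]
    fun_prop
  simp only [hq]
  constructor
  · rw [← integral_map (φ := Y) hY.aemeasurable (f := fun x => (∑ i, g i (x i)) + c)
      hgm.aestronglyMeasurable, hlaw]
    have hint (i : ι) : Integrable (fun x : ι → ℝ => g i (x i)) P :=
      integrable_comp_eval ((hmem i).integrable (by norm_num))
    rw [integral_add (integrable_finsetSum _ fun i _ => hint i) (integrable_const _),
      integral_finsetSum _ fun i _ => hint i]
    have hi (i : ι) : ∫ x, g i (x i) ∂P = A * (v + m i ^ 2) + B i * m i := by
      rw [integral_comp_eval (μ := fun i => gaussianReal (m i) v) (f := g i)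
        (hmem i).aestronglyMeasurable]
      exact integral_quadratic_gaussianReal_s17 _ _ _ _
    simp only [hi, Finset.sum_add_distrib, ← Finset.mul_sum, dotProduct]
    simp [pow_two]
  · have h1 : Var[fun ω => (∑ i, g i (Y ω i)) + c; ν] =
        Var[fun x : ι → ℝ => (∑ i, g i (x i)) + c; P] := by
      rw [← hlaw, variance_map hgm.aemeasurable hY.aemeasurable]
      rfl
    have h2 := variance_sum_pi (μ := fun i => gaussianReal (m i) v) hmem
    have h3 : (∑ i, fun ω : ι → ℝ => g i (ω i)) = fun x => ∑ i, g i (x i) := by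
      ext x
      simp
    rw [h1, variance_add_const hgs.aestronglyMeasurable, ← h3, h2]
    simp only [hg, variance_quadratic_gaussianReal_s17, Finset.sum_add_distrib, ← Finset.mul_sum,
      dotProduct]
    simp [pow_two]
    ring

lemma pi_gaussianReal_eq_withDensity {ι : Type*} [Fintype ι] (m : ι → ℝ) {v : ℝ≥0}
    (hv : v ≠ 0) :
    (Measure.pi fun i => gaussianReal (m i) v) =
      volume.withDensity fun x => ENNReal.ofReal (∏ i, gaussianPDFReal (m i) v (x i)) := by
  refine Measure.pi_eq fun s hs => ?_
  rw [withDensity_apply _ (MeasurableSet.univ_pi hs), volume_pi, Measure.restrict_pi_pi,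
    ← ofReal_integral_eq_lintegral_ofReal
      (Integrable.fintype_prod fun i => (integrable_gaussianPDFReal (m i) v).restrict)
      (ae_of_all _ fun x => Finset.prod_nonneg fun i _ => gaussianPDFReal_nonneg _ _ _),
    integral_fintype_prod_eq_prod, ENNReal.ofReal_prod_of_nonneg fun i _ =>
      integral_nonneg fun x => gaussianPDFReal_nonneg _ _ _]
  exact Finset.prod_congr rfl fun i _ => (gaussianReal_apply_eq_integral _ hv _).symm

lemma gaussDensity_smul_one {d : ℕ} (m : Fin d → ℝ) {v : ℝ} (hv : 0 < v) (x : Fin d → ℝ) :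
    gaussDensity m (v • (1 : Matrix (Fin d) (Fin d) ℝ)) x =
      (Real.sqrt ((2 * Real.pi * v) ^ d))⁻¹ *
        Real.exp (-(1 / 2) * (v⁻¹ * ((x - m) ⬝ᵥ (x - m)))) := by
  have hinv : (v • (1 : Matrix (Fin d) (Fin d) ℝ))⁻¹ = v⁻¹ • 1 := by
    refine Matrix.inv_eq_left_inv ?_
    simp [smul_smul, hv.ne']
  simp [gaussDensity, hinv, mul_pow, Matrix.smul_mulVec]

lemma gaussDensity_eq_prod {d : ℕ} (m : Fin d → ℝ) {v : ℝ≥0} (hv : 0 < v) (x : Fin d → ℝ) :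
    gaussDensity m ((v : ℝ) • (1 : Matrix (Fin d) (Fin d) ℝ)) x =
      ∏ i, gaussianPDFReal (m i) v (x i) := by
  rw [gaussDensity_smul_one m (by exact_mod_cast hv)]
  simp only [gaussianPDFReal, Finset.prod_mul_distrib, ← Real.exp_sum, Finset.prod_const,
    Finset.card_univ, Fintype.card_fin]
  have hsqrt : √((2 * Real.pi * v) ^ d) = √(2 * Real.pi * v) ^ d := by
    rw [Real.sqrt_eq_iff_mul_self_eq (by positivity) (by positivity), ← mul_pow,
      Real.mul_self_sqrt (by positivity)]
  rw [hsqrt, inv_pow]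
  congr 2
  simp only [dotProduct, Finset.mul_sum, Pi.sub_apply]
  refine Finset.sum_congr rfl fun i _ => ?_
  have : (v : ℝ) ≠ 0 := by exact_mod_cast hv.ne'
  field_simp

lemma log_gaussDensity_smul_one {d : ℕ} (m : Fin d → ℝ) {v : ℝ} (hv : 0 < v)
    (x : Fin d → ℝ) :
    0 < gaussDensity m (v • (1 : Matrix (Fin d) (Fin d) ℝ)) x ∧
    Real.log (gaussDensity m (v • (1 : Matrix (Fin d) (Fin d) ℝ)) x) =
      -((d : ℝ) / 2) * (Real.log (2 * Real.pi) + Real.log v)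
        - (1 / 2) * v⁻¹ * (x ⬝ᵥ x - 2 * (m ⬝ᵥ x) + m ⬝ᵥ m) := by
  rw [gaussDensity_smul_one m hv]
  refine ⟨by positivity, ?_⟩
  rw [Real.log_mul (by positivity) (by positivity), Real.log_exp, Real.log_inv,
    Real.log_sqrt (by positivity), Real.log_pow, Real.log_mul (by positivity) hv.ne']
  simp only [sub_dotProduct, dotProduct_sub, dotProduct_comm x m]
  ring

/-- Conditioning on an event of `S` keeps a variable independent of `(X, S)` independent of `X`
and does not change its law. -/
lemma map_prodMk_cond_of_indepFun {Ω E F G : Type*} [MeasurableSpace Ω] [MeasurableSpace E]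
    [MeasurableSpace F] [MeasurableSpace G] {μ : Measure Ω} [IsProbabilityMeasure μ]
    {X : Ω → E} {S : Ω → F} {Z : Ω → G} (hX : Measurable X) (hS : Measurable S)
    (hZ : Measurable Z) (h : IndepFun Z (fun ω => (X ω, S ω)) μ) {t : Set F}
    (ht : MeasurableSet t) (hpos : μ (S ⁻¹' t) ≠ 0) :
    (μ[|S ⁻¹' t]).map (fun ω => (X ω, Z ω)) = ((μ[|S ⁻¹' t]).map X).prod (μ.map Z) := by
  have : IsProbabilityMeasure (μ[|S ⁻¹' t]) := cond_isProbabilityMeasure hpos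
  have : IsProbabilityMeasure ((μ[|S ⁻¹' t]).map X) :=
    Measure.isProbabilityMeasure_map hX.aemeasurable
  have : IsProbabilityMeasure (μ.map Z) := Measure.isProbabilityMeasure_map hZ.aemeasurable
  refine (Measure.prod_eq fun u w hu hw => ?_).symm
  rw [Measure.map_apply (hX.prodMk hZ) (hu.prod hw), Measure.map_apply hX hu,
    Measure.map_apply hZ hw, cond_apply (hS ht), cond_apply (hS ht)]
  have hi := h.measure_inter_preimage_eq_mul w (u ×ˢ t) hw (hu.prod ht)
  have e1 : S ⁻¹' t ∩ (fun ω => (X ω, Z ω)) ⁻¹' u ×ˢ w =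
      Z ⁻¹' w ∩ (fun ω => (X ω, S ω)) ⁻¹' u ×ˢ t := by
    ext ω
    simp only [Set.mem_inter_iff, Set.mem_preimage, Set.mem_prod]
    tauto
  have e2 : S ⁻¹' t ∩ X ⁻¹' u = (fun ω => (X ω, S ω)) ⁻¹' u ×ˢ t := by
    ext ω
    simp only [Set.mem_inter_iff, Set.mem_preimage, Set.mem_prod]
    tauto
  rw [e1, e2, hi]
  ring

lemma map_add_mul_gaussianReal_prod (m₁ m₂ σ : ℝ) (v₁ v₂ : ℝ≥0) :
    ((gaussianReal m₁ v₁).prod (gaussianReal m₂ v₂)).map (fun q => q.1 + σ * q.2) =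
      gaussianReal (m₁ + σ * m₂) (v₁ + NNReal.mk (σ ^ 2) (sq_nonneg σ) * v₂) := by
  rw [← gaussianReal_conv_gaussianReal, ← gaussianReal_map_const_mul, Measure.conv,
    ← Measure.map_id (μ := gaussianReal m₁ v₁), Measure.map_prod_map _ _ (by fun_prop) (by fun_prop),
    Measure.map_map (by fun_prop) (by fun_prop), Measure.map_id]
  rfl

lemma map_add_smul_pi_gaussianReal {ι : Type*} [Fintype ι] (m₁ m₂ : ι → ℝ) (σ : ℝ)
    (v₁ v₂ : ℝ≥0) :
    ((Measure.pi fun i => gaussianReal (m₁ i) v₁).prod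
        (Measure.pi fun i => gaussianReal (m₂ i) v₂)).map (fun q => q.1 + σ • q.2) =
      Measure.pi fun i => gaussianReal (m₁ i + σ * m₂ i) (v₁ + NNReal.mk (σ ^ 2) (sq_nonneg σ) * v₂) := by
  have h := measurePreserving_arrowProdEquivProdArrow ℝ ℝ ι
    (fun i => gaussianReal (m₁ i) v₁) (fun i => gaussianReal (m₂ i) v₂)
  have hp := measurePreserving_pi
    (fun i => (gaussianReal (m₁ i) v₁).prod (gaussianReal (m₂ i) v₂))
    (fun i => gaussianReal (m₁ i + σ * m₂ i) (v₁ + NNReal.mk (σ ^ 2) (sq_nonneg σ) * v₂))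
    (f := fun _ q => q.1 + σ * q.2)
    fun i => ⟨by fun_prop, map_add_mul_gaussianReal_prod _ _ _ _ _⟩
  rw [← h.map_eq, Measure.map_map (by fun_prop) h.measurable, ← hp.map_eq]
  rfl

/-- The conditional law of `X + σ Z` given `S ∈ t` when `X` is conditionally isotropic Gaussian and
`Z` is an independent standard Gaussian vector. -/
lemma map_add_smul_cond {Ω : Type*} [MeasurableSpace Ω] {μ : Measure Ω} [IsProbabilityMeasure μ]
    {d : ℕ} {X : Ω → Fin d → ℝ} {S : Ω → ℝ} {Z : Ω → Fin d → ℝ} (hX : Measurable X)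
    (hS : Measurable S) (hZ : Measurable Z)
    (hZlaw : μ.map Z = Measure.pi fun _ : Fin d => gaussianReal 0 1)
    (hindep : IndepFun Z (fun ω => (X ω, S ω)) μ) {t : Set ℝ} (ht : MeasurableSet t)
    (hpos : μ (S ⁻¹' t) ≠ 0) {m : Fin d → ℝ} {s : ℝ} (hs : 0 < s)
    (hXlaw : (μ[|S ⁻¹' t]).map X = volume.withDensity fun x =>
      ENNReal.ofReal (gaussDensity m (s ^ 2 • (1 : Matrix (Fin d) (Fin d) ℝ)) x)) (σ : ℝ) :
    (μ[|S ⁻¹' t]).map (fun ω => X ω + σ • Z ω) =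
      Measure.pi fun i => gaussianReal (m i) (Real.toNNReal (s ^ 2 + σ ^ 2)) := by
  have hv : (0 : ℝ≥0) < (s ^ 2).toNNReal := Real.toNNReal_pos.2 (by positivity)
  have hc : ((s ^ 2).toNNReal : ℝ) = s ^ 2 := Real.coe_toNNReal _ (sq_nonneg s)
  have hXpi : (μ[|S ⁻¹' t]).map X =
      Measure.pi fun i => gaussianReal (m i) (s ^ 2).toNNReal := by
    rw [hXlaw, pi_gaussianReal_eq_withDensity m hv.ne']
    congr with x
    rw [← gaussDensity_eq_prod m hv, hc]
  have hcomp : (fun ω => X ω + σ • Z ω) =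
      (fun q : (Fin d → ℝ) × (Fin d → ℝ) => q.1 + σ • q.2) ∘ fun ω => (X ω, Z ω) := rfl
  rw [hcomp, ← Measure.map_map (by fun_prop) (by fun_prop),
    map_prodMk_cond_of_indepFun hX hS hZ hindep ht hpos, hXpi, hZlaw,
    map_add_smul_pi_gaussianReal m (fun _ => 0) σ _ 1]
  have hsum : (s ^ 2).toNNReal + NNReal.mk (σ ^ 2) (sq_nonneg σ) * 1 =
      (s ^ 2 + σ ^ 2).toNNReal := by
    ext
    simp [hc, Real.coe_toNNReal _ (add_nonneg (sq_nonneg s) (sq_nonneg σ))]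
  simp only [hsum, mul_zero, add_zero]

lemma log_odds_eq_quadratic {d : ℕ} {p : ℝ} (hp : p ∈ Set.Ioo (0 : ℝ) 1) (μ0 μ1 : Fin d → ℝ)
    {v0 v1 : ℝ} (hv0 : 0 < v0) (hv1 : 0 < v1) (x : Fin d → ℝ) :
    Real.log (p * gaussDensity μ1 (v1 • (1 : Matrix (Fin d) (Fin d) ℝ)) x /
        ((1 - p) * gaussDensity μ0 (v0 • (1 : Matrix (Fin d) (Fin d) ℝ)) x)) =
      (v1 - v0) / (2 * v1 * v0) * (x ⬝ᵥ x) + ((v1 * v0)⁻¹ • (v0 • μ1 - v1 • μ0)) ⬝ᵥ x +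
        ((1 / 2) * v0⁻¹ * (μ0 ⬝ᵥ μ0) - (1 / 2) * v1⁻¹ * (μ1 ⬝ᵥ μ1)
          + ((d : ℝ) / 2) * Real.log (v0 / v1) + Real.log (p / (1 - p))) := by
  obtain ⟨h0, l0⟩ := log_gaussDensity_smul_one μ0 hv0 x
  obtain ⟨h1, l1⟩ := log_gaussDensity_smul_one μ1 hv1 x
  have hp0 : p ≠ 0 := hp.1.ne'
  have hp1 : 1 - p ≠ 0 := (sub_pos.2 hp.2).ne'
  rw [Real.log_div (mul_ne_zero hp0 h1.ne') (mul_ne_zero hp1 h0.ne'), Real.log_mul hp0 h1.ne',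
    Real.log_mul hp1 h0.ne', Real.log_div hp0 hp1, Real.log_div hv0.ne' hv1.ne', l0, l1]
  simp only [smul_dotProduct, sub_dotProduct, smul_eq_mul]
  field_simp
  ring

/-- Isotropic class-conditional Gaussians: conditional means and
variances of the log posterior-odds `θ^σ(X^σ)` given `S`. -/
theorem conditional_moments_log_odds_isotropic
    {Ω : Type*} [MeasurableSpace Ω] (μ : Measure Ω) [IsProbabilityMeasure μ]
    {d : ℕ}
    (X : Ω → (Fin d → ℝ)) (S : Ω → ℝ) (Z : Ω → (Fin d → ℝ))
    (hX : Measurable X) (hS : Measurable S) (hZ : Measurable Z)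
    (p : ℝ) (hp : p ∈ Set.Ioo (0 : ℝ) 1)
    (hS01 : ∀ ω, S ω = 0 ∨ S ω = 1)
    (hSlaw : μ {ω | S ω = 1} = ENNReal.ofReal p)
    -- conditional law of X given S = s is N(μ_s, σ_s² I)
    (μ0 μ1 : Fin d → ℝ) (s0 s1 : ℝ) (hs0 : 0 < s0) (hs1 : 0 < s1)
    (hX0 : Measure.map X (μ[|{ω | S ω = 0}])
      = volume.withDensity fun x =>
          ENNReal.ofReal (gaussDensity μ0 (s0 ^ 2 • (1 : Matrix (Fin d) (Fin d) ℝ)) x))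
    (hX1 : Measure.map X (μ[|{ω | S ω = 1}])
      = volume.withDensity fun x =>
          ENNReal.ofReal (gaussDensity μ1 (s1 ^ 2 • (1 : Matrix (Fin d) (Fin d) ℝ)) x))
    (σ : ℝ) (hσ : 0 < σ)
    (hZlaw : Measure.map Z μ = Measure.pi fun _ : Fin d => gaussianReal 0 1)
    (hZindep : IndepFun Z (fun ω => (X ω, S ω)) μ)
    (Xσ : Ω → (Fin d → ℝ)) (hXσ : Xσ = fun ω => X ω + σ • Z ω)
    -- the conditional densities f_s^σ of X^σ given S = s and the log posterior-odds θ^σ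
    (f0 f1 : (Fin d → ℝ) → ℝ)
    (hf0 : f0 = gaussDensity μ0 ((s0 ^ 2 + σ ^ 2) • (1 : Matrix (Fin d) (Fin d) ℝ)))
    (hf1 : f1 = gaussDensity μ1 ((s1 ^ 2 + σ ^ 2) • (1 : Matrix (Fin d) (Fin d) ℝ)))
    (θ : (Fin d → ℝ) → ℝ) (hθ : θ = fun x => Real.log (p * f1 x / ((1 - p) * f0 x)))
    -- the coefficients a, b, c of θ^σ(x) = a‖x‖² + bᵀx + c
    (a : ℝ) (ha : a = (s1 ^ 2 - s0 ^ 2) / (2 * (s1 ^ 2 + σ ^ 2) * (s0 ^ 2 + σ ^ 2)))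
    (b : Fin d → ℝ)
    (hb : b = ((s1 ^ 2 + σ ^ 2) * (s0 ^ 2 + σ ^ 2))⁻¹ •
      ((s0 ^ 2 + σ ^ 2) • μ1 - (s1 ^ 2 + σ ^ 2) • μ0))
    (c : ℝ) (hc : c = (1 / 2) * (s0 ^ 2 + σ ^ 2)⁻¹ * (μ0 ⬝ᵥ μ0)
      - (1 / 2) * (s1 ^ 2 + σ ^ 2)⁻¹ * (μ1 ⬝ᵥ μ1)
      + ((d : ℝ) / 2) * Real.log ((s0 ^ 2 + σ ^ 2) / (s1 ^ 2 + σ ^ 2))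
      + Real.log (p / (1 - p))) :
    -- E[θ^σ(X^σ) | S = 0]
    (∫ ω, θ (Xσ ω) ∂(μ[|{ω | S ω = 0}])
      = ((d : ℝ) / 2) * ((s1 ^ 2 - s0 ^ 2) / (s1 ^ 2 + σ ^ 2)) + c
        + (2 * (s0 ^ 2 + σ ^ 2) * (μ1 ⬝ᵥ μ0)
            - (s1 ^ 2 + s0 ^ 2 + 2 * σ ^ 2) * (μ0 ⬝ᵥ μ0))
          / (2 * (s1 ^ 2 + σ ^ 2) * (s0 ^ 2 + σ ^ 2)))
    ∧
    -- E[θ^σ(X^σ) | S = 1]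
    (∫ ω, θ (Xσ ω) ∂(μ[|{ω | S ω = 1}])
      = ((d : ℝ) / 2) * ((s1 ^ 2 - s0 ^ 2) / (s0 ^ 2 + σ ^ 2)) + c
        + ((s1 ^ 2 + s0 ^ 2 + 2 * σ ^ 2) * (μ1 ⬝ᵥ μ1)
            - 2 * (s1 ^ 2 + σ ^ 2) * (μ1 ⬝ᵥ μ0))
          / (2 * (s1 ^ 2 + σ ^ 2) * (s0 ^ 2 + σ ^ 2)))
    ∧
    -- Var(θ^σ(X^σ) | S = 0)
    (∫ ω, (θ (Xσ ω) - ∫ ω', θ (Xσ ω') ∂(μ[|{ω | S ω = 0}])) ^ 2 ∂(μ[|{ω | S ω = 0}])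
      = ((d : ℝ) * (s1 ^ 2 - s0 ^ 2) ^ 2
          + 2 * (s0 ^ 2 + σ ^ 2) * ((μ1 - μ0) ⬝ᵥ (μ1 - μ0)))
        / (2 * (s1 ^ 2 + σ ^ 2) ^ 2))
    ∧
    -- Var(θ^σ(X^σ) | S = 1)
    (∫ ω, (θ (Xσ ω) - ∫ ω', θ (Xσ ω') ∂(μ[|{ω | S ω = 1}])) ^ 2 ∂(μ[|{ω | S ω = 1}])
      = ((d : ℝ) * (s1 ^ 2 - s0 ^ 2) ^ 2
          + 2 * (s1 ^ 2 + σ ^ 2) * ((μ1 - μ0) ⬝ᵥ (μ1 - μ0)))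
        / (2 * (s0 ^ 2 + σ ^ 2) ^ 2)) := by
  have hE0 : {ω | S ω = 0} = S ⁻¹' {0} := rfl
  have hE1 : {ω | S ω = 1} = S ⁻¹' {1} := rfl
  have hpos1 : μ (S ⁻¹' {1}) ≠ 0 := by
    rw [← hE1, hSlaw]
    simpa using hp.1
  have hpos0 : μ (S ⁻¹' {0}) ≠ 0 := by
    intro h
    have hcompl : S ⁻¹' {0} = (S ⁻¹' {1})ᶜ := by
      ext ω
      rcases hS01 ω with h | h <;> simp [h]
    rw [hcompl, prob_compl_eq_zero_iff (hS (measurableSet_singleton 1)), ← hE1, hSlaw,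
      ENNReal.ofReal_eq_one] at h
    exact hp.2.ne h
  have hv0 : 0 < s0 ^ 2 + σ ^ 2 := by positivity
  have hv1 : 0 < s1 ^ 2 + σ ^ 2 := by positivity
  have hXσm : Measurable Xσ := by
    rw [hXσ]
    fun_prop
  have hlaw0 := map_add_smul_cond hX hS hZ hZlaw hZindep (measurableSet_singleton 0) hpos0 hs0
    hX0 σ
  have hlaw1 := map_add_smul_cond hX hS hZ hZlaw hZindep (measurableSet_singleton 1) hpos1 hs1
    hX1 σ
  rw [← hXσ] at hlaw0 hlaw1
  have hθq : ∀ x, θ x = a * (x ⬝ᵥ x) + b ⬝ᵥ x + c := fun x => by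
    have hd : s1 ^ 2 + σ ^ 2 - (s0 ^ 2 + σ ^ 2) = s1 ^ 2 - s0 ^ 2 := by ring
    simp only [hθ, hf0, hf1, log_odds_eq_quadratic hp μ0 μ1 hv0 hv1, ha, hb, hc, hd]
  have hθm : Measurable θ := by
    rw [funext hθq]
    simp only [dotProduct]
    fun_prop
  have hvar (ν : Measure Ω) : ∫ ω, (θ (Xσ ω) - ∫ ω', θ (Xσ ω') ∂ν) ^ 2 ∂ν =
      Var[fun ω => θ (Xσ ω); ν] :=
    (variance_eq_integral (hθm.comp hXσm).aemeasurable).symm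
  obtain ⟨e0, w0⟩ := moments_quadratic_pi_gaussianReal hXσm μ0 _ hlaw0 a b c
  obtain ⟨e1, w1⟩ := moments_quadratic_pi_gaussianReal hXσm μ1 _ hlaw1 a b c
  simp only [Real.coe_toNNReal _ hv0.le, Real.coe_toNNReal _ hv1.le, Fintype.card_fin]
    at e0 w0 e1 w1
  rw [hvar, hvar]
  simp only [hθq, hE0, hE1]
  rw [e0, e1, w0, w1, ha, hb]
  set v0 := s0 ^ 2 + σ ^ 2 with hv0_def
  set v1 := s1 ^ 2 + σ ^ 2 with hv1_def
  have hd : s1 ^ 2 - s0 ^ 2 = v1 - v0 := by ring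
  have hsum : s1 ^ 2 + s0 ^ 2 + 2 * σ ^ 2 = v1 + v0 := by ring
  rw [hd, hsum]
  clear_value v0 v1
  simp only [smul_dotProduct, dotProduct_smul, sub_dotProduct, dotProduct_sub, add_dotProduct,
    dotProduct_add, smul_eq_mul, dotProduct_comm μ0 μ1]
  refine ⟨?_, ?_, ?_, ?_⟩ <;> field_simp <;> ring
end
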